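/- If Q is a basic sequence which is fully divergent, non-decreasing, and infinite in limit, and S is a set of positive integers almost closed under addition, then the set RN^{I}(Q) ∩ RN^{II}(Q) ∩ N^{I}_{Ab}(Q) ∩ ⋂_{k∈S} N_k(Q) \ (N^{II}(Q) ∪ ⋃_{k∉S} N_k(Q)) is non-empty. -/

import Mathlib

open Filter MeasureTheory Finset
open scoped Topology Classical

/-- A basic sequence: a sequence of integers, each at least `2`. -/
def IsBasic (q : ℕ → ℕ) : Prop := ∀ n, 2 ≤ q n

/-- The product `q_0 q_1 ⋯ q_{n-1}` of the first `n` terms of the basic sequence. -/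
def qprod (q : ℕ → ℕ) (n : ℕ) : ℝ := ∏ i ∈ Finset.range n, (q i : ℝ)

/-- `T_{Q,n}(x) = (q_0 q_1 ⋯ q_{n-1}) x mod 1`. -/
noncomputable def TQ (q : ℕ → ℕ) (n : ℕ) (x : ℝ) : ℝ := Int.fract (qprod q n * x)

/-- The `n`-th digit `E_n` of the `Q`-Cantor series expansion of `x`
(digit positions are indexed by `0, 1, 2, …`). -/
noncomputable def qdigit (q : ℕ → ℕ) (x : ℝ) (n : ℕ) : ℕ := ⌊(q n : ℝ) * TQ q n x⌋₊

/-- `N_n^Q(B,x)`: the number of occurrences of the block `B` starting among the first `n`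
digit positions of the `Q`-Cantor series expansion of `x`. -/
noncomputable def blockCount (q : ℕ → ℕ) (x : ℝ) {k : ℕ} (B : Fin k → ℕ) (n : ℕ) : ℕ :=
  ((Finset.range n).filter fun i => ∀ j : Fin k, qdigit q x (i + (j : ℕ)) = B j).card

/-- `Q_n^{(k)} = ∑_{j<n} 1/(q_j q_{j+1} ⋯ q_{j+k-1})`. -/
noncomputable def Qsum (q : ℕ → ℕ) (k n : ℕ) : ℝ :=
  ∑ j ∈ Finset.range n, (∏ i ∈ Finset.range k, (q (j + i) : ℝ))⁻¹

/-- `x` is `Q`-normal of order `k`: every block of length `k` occurs with the expected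
asymptotic frequency. -/
def QNormalOfOrder (q : ℕ → ℕ) (k : ℕ) (x : ℝ) : Prop :=
  ∀ B : Fin k → ℕ,
    Tendsto (fun n => (blockCount q x B n : ℝ) / Qsum q k n) atTop (𝓝 1)

/-- `x ∈ N(Q)`: `x` is `Q`-normal of every order `k ≥ 1`. -/
def QNormal (q : ℕ → ℕ) (x : ℝ) : Prop := ∀ k, 1 ≤ k → QNormalOfOrder q k x

/-- `Q` is fully divergent: `Q_n^{(k)} → ∞` for every `k ≥ 1`. -/
def FullyDivergent (q : ℕ → ℕ) : Prop :=
  ∀ k, 1 ≤ k → Tendsto (fun n => Qsum q k n) atTop atTop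

/-- `Q` is infinite in limit: `q_n → ∞`. -/
def InfiniteInLimit (q : ℕ → ℕ) : Prop := Tendsto q atTop atTop

/-- `N_{n,m,r}^Q(B,x)`: occurrences of the block `B` (of length `m`) starting at
positions `i < n` with `i ≡ r (mod m)`. -/
noncomputable def apCount (q : ℕ → ℕ) (x : ℝ) (m r : ℕ) (B : Fin m → ℕ) (n : ℕ) : ℕ :=
  ((Finset.range n).filter fun i =>
    i % m = r ∧ ∀ j : Fin m, qdigit q x (i + (j : ℕ)) = B j).card

/-- `Q_n^{(m,r)} = ∑_{j=0}^{⌊(n-r)/m⌋} 1/(q_{mj+r} q_{mj+r+1} ⋯ q_{mj+r+m-1})`. -/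
noncomputable def apQsum (q : ℕ → ℕ) (m r n : ℕ) : ℝ :=
  ∑ j ∈ Finset.range ((n - r) / m + 1),
    (∏ i ∈ Finset.range m, (q (m * j + r + i) : ℝ))⁻¹

/-- `x ∈ N^{I}_{m,r}(Q)`. -/
def MemNAPI (q : ℕ → ℕ) (m r : ℕ) (x : ℝ) : Prop :=
  ∀ B : Fin m → ℕ,
    Tendsto (fun n => (apCount q x m r B n : ℝ) / apQsum q m r n) atTop (𝓝 1)

/-- `x ∈ N^{I}_{Ab}(Q)`: `x` is AP `Q`-abnormal of type I. -/
def APAbnormalI (q : ℕ → ℕ) (x : ℝ) : Prop :=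
  ∀ m, 2 ≤ m → ∀ r, r < m → ¬ MemNAPI q m r x

/-- `x ∈ RN^{I}(Q)`. -/
def MemRNI (q : ℕ → ℕ) (x : ℝ) : Prop :=
  ∀ m, 1 ≤ m → ∀ r, r < m → ∀ B₁ B₂ : Fin m → ℕ,
    Tendsto (fun n => (apCount q x m r B₁ n : ℝ) / (apCount q x m r B₂ n : ℝ))
      atTop (𝓝 1)

/-- `Λ_{m,r}(Q) = (q_{mt+r})_t`. -/
def lamQ (q : ℕ → ℕ) (m r : ℕ) : ℕ → ℕ := fun t => q (m * t + r)

/-- `Υ_{Q,m,r}(x)`: the real number whose `Λ_{m,r}(Q)`-Cantor series digits are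
`(E_{mt+r})_t`, where `(E_n)` are the `Q`-Cantor series digits of `x`. -/
noncomputable def Ups (q : ℕ → ℕ) (m r : ℕ) (x : ℝ) : ℝ :=
  ∑' t : ℕ, (qdigit q x (m * t + r) : ℝ) / ∏ i ∈ Finset.range (t + 1), (lamQ q m r i : ℝ)

/-- `x ∈ N^{II}_{k,m,r}(Q) = Υ_{Q,m,r}^{-1}(N_k(Λ_{m,r}(Q)))`. -/
def MemNAPII (q : ℕ → ℕ) (k m r : ℕ) (x : ℝ) : Prop :=
  QNormalOfOrder (lamQ q m r) k (Ups q m r x)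

/-- `x ∈ N^{II}(Q)`: `x` is AP `Q`-normal of type II. -/
def APNormalII (q : ℕ → ℕ) (x : ℝ) : Prop :=
  ∀ k, 1 ≤ k → ∀ m, 1 ≤ m → ∀ r, r < m → MemNAPII q k m r x

/-- `x ∈ RN^{II}(Q)`: for all `k, m, r` the counts in `Υ_{Q,m,r}(x)` of any two blocks of
length `k` with respect to `Λ_{m,r}(Q)` have ratio tending to `1`. -/
def MemRNII (q : ℕ → ℕ) (x : ℝ) : Prop :=
  ∀ k, 1 ≤ k → ∀ m, 1 ≤ m → ∀ r, r < m → ∀ B₁ B₂ : Fin k → ℕ,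
    Tendsto (fun n =>
      (blockCount (lamQ q m r) (Ups q m r x) B₁ n : ℝ) /
      (blockCount (lamQ q m r) (Ups q m r x) B₂ n : ℝ)) atTop (𝓝 1)

/-- `S` (a set of positive integers) is almost closed under addition: for every `k ∈ S`,
the set `{x ∉ S : x + k ∈ S}` has asymptotic density `0`. -/
def AlmostClosed (S : Set ℕ) : Prop :=
  ∀ k ∈ S, Tendsto
    (fun t : ℕ => (((Finset.Icc 1 t).filter fun x => x ∉ S ∧ x + k ∈ S).card : ℝ) / t)
    atTop (𝓝 0)

/-- The sequence `u` of reals is uniformly distributed mod 1. -/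
def UDMod1 (u : ℕ → ℝ) : Prop :=
  ∀ a b : ℝ, 0 ≤ a → a < b → b ≤ 1 →
    Tendsto (fun N => (((Finset.range N).filter fun n => u n ∈ Set.Ico a b).card : ℝ) / N)
      atTop (𝓝 (b - a))

/-- `x ∈ DN(Q)`: `x` is `Q`-distribution normal. -/
def DistNormal (q : ℕ → ℕ) (x : ℝ) : Prop := UDMod1 fun n => TQ q n x

/-- `x ∈ DN_{Ab}(Q)`: `x` is AP `Q`-distribution abnormal. -/
def APDistAbnormal (q : ℕ → ℕ) (x : ℝ) : Prop :=
  ∀ m, 2 ≤ m → ∀ r, r < m → ¬ UDMod1 fun n => TQ q (m * n + r) x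

/-- `y ∈ D_{(x_n)}(Q)`: for every `ξ ∈ (0,1)`, the proportion of `n ≤ N` with
`fract (T_{Q,n}(y) - x_n) < ξ` tends to `1`. -/
def MemD (q : ℕ → ℕ) (xs : ℕ → ℝ) (y : ℝ) : Prop :=
  ∀ ξ : ℝ, 0 < ξ → ξ < 1 →
    Tendsto (fun N =>
      (((Finset.range N).filter fun n => Int.fract (TQ q n y - xs n) < ξ).card : ℝ) / N)
      atTop (𝓝 1)

/-- A computable real number. -/
def ComputableReal (x : ℝ) : Prop :=
  ∃ f : ℕ → ℕ, Computable f ∧ ∀ n : ℕ, 0 < n → (f n : ℝ) / n ≤ x ∧ x ≤ ((f n : ℝ) + 1) / n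

/-- The indicator function `1_{ℕ∖S}` of the complement of `S`, with values in `ℤ`. -/
noncomputable def indZ (S : Set ℕ) (i : ℕ) : ℤ := if i ∈ S then 0 else 1

/-- The indicator function `1_{ℕ∖S}` of the complement of `S`, with values in `ℝ`. -/
noncomputable def indR (S : Set ℕ) (i : ℕ) : ℝ := if i ∈ S then 0 else 1

/-- The coefficients `c_{t,i}`: `c_{t,1} = t (1+ε)^{1_{ℕ∖S}(1)}` and
`c_{t,i} = (1+ε)^{1_{ℕ∖S}(i) - 1_{ℕ∖S}(i-1)}` for `i ≥ 2`. -/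
noncomputable def coeff (S : Set ℕ) (ε : ℝ) (t i : ℕ) : ℝ :=
  if i = 1 then (t : ℝ) * (1 + ε) ^ indZ S 1
  else (1 + ε) ^ (indZ S i - indZ S (i - 1))

/-- `N_k(b)`: the set of real numbers normal of order `k` in base `b`. -/
def BaseNormalOfOrder (b k : ℕ) : Set ℝ :=
  {x | ∀ B : Fin k → ℕ, (∀ j, B j < b) →
    Tendsto (fun n => (blockCount (fun _ => b) x B n : ℝ) / n) atTop
      (𝓝 (((b : ℝ) ^ k)⁻¹))}

/-! ### Cantor series with prescribed digits -/

/-- The sum of the `q`-Cantor series with digits `E`. -/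
noncomputable def cantorSum (q E : ℕ → ℕ) : ℝ :=
  ∑' t : ℕ, (E t : ℝ) / ∏ i ∈ Finset.range (t + 1), (q i : ℝ)

lemma IsBasic.prod_pos {q : ℕ → ℕ} (hq : IsBasic q) (s : Finset ℕ) :
    0 < ∏ i ∈ s, (q i : ℝ) :=
  Finset.prod_pos fun i _ => by have := hq i; positivity

lemma sum_cantor_le {q E : ℕ → ℕ} (hq : IsBasic q) (hE : ∀ n, E n ≤ q n - 2) (n : ℕ) :
    ∑ t ∈ Finset.range n, (E t : ℝ) / ∏ i ∈ Finset.range (t + 1), (q i : ℝ) ≤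
      1 - (∏ i ∈ Finset.range n, (q i : ℝ))⁻¹ := by
  induction n with
  | zero => simp
  | succ n ih =>
    rw [Finset.sum_range_succ]
    have hp := hq.prod_pos (Finset.range n)
    have hqn : (2 : ℝ) ≤ q n := by exact_mod_cast hq n
    have hEn : (E n : ℝ) + 1 ≤ q n := by
      have h1 := hE n
      have h2 := hq n
      exact_mod_cast (by omega : E n + 1 ≤ q n)
    have key : (E n : ℝ) / ∏ i ∈ Finset.range (n + 1), (q i : ℝ) +
        (∏ i ∈ Finset.range (n + 1), (q i : ℝ))⁻¹ ≤ (∏ i ∈ Finset.range n, (q i : ℝ))⁻¹ := by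
      rw [Finset.prod_range_succ, ← one_div, ← one_div, ← add_div,
        div_le_div_iff₀ (by positivity) hp]
      nlinarith
    linarith

lemma summable_cantor {q E : ℕ → ℕ} (hq : IsBasic q) (hE : ∀ n, E n ≤ q n - 2) :
    Summable fun t : ℕ => (E t : ℝ) / ∏ i ∈ Finset.range (t + 1), (q i : ℝ) := by
  refine summable_of_sum_range_le (c := 1)
    (fun t => div_nonneg (Nat.cast_nonneg _) (hq.prod_pos _).le) fun n => ?_
  have := sum_cantor_le hq hE n
  have := inv_pos.2 (hq.prod_pos (Finset.range n))
  linarith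

lemma cantorSum_nonneg {q E : ℕ → ℕ} (hq : IsBasic q) : 0 ≤ cantorSum q E :=
  tsum_nonneg fun _ => div_nonneg (Nat.cast_nonneg _) (hq.prod_pos _).le

lemma cantorSum_le_one {q E : ℕ → ℕ} (hq : IsBasic q) (hE : ∀ n, E n ≤ q n - 2) :
    cantorSum q E ≤ 1 := by
  refine Real.tsum_le_of_sum_range_le
    (fun t => div_nonneg (Nat.cast_nonneg _) (hq.prod_pos _).le) fun n => ?_
  have := sum_cantor_le hq hE n
  have := inv_pos.2 (hq.prod_pos (Finset.range n))
  linarith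

lemma mul_cantorSum {q E : ℕ → ℕ} (hq : IsBasic q) (hE : ∀ n, E n ≤ q n - 2) :
    (q 0 : ℝ) * cantorSum q E =
      E 0 + cantorSum (fun i => q (i + 1)) (fun i => E (i + 1)) := by
  have hq0 : (q 0 : ℝ) ≠ 0 := by have := hq 0; positivity
  rw [cantorSum, (summable_cantor hq hE).tsum_eq_zero_add, mul_add, ← tsum_mul_left, cantorSum]
  congr 1
  · simp [mul_div_cancel₀ _ hq0]
  · refine tsum_congr fun t => ?_
    rw [Finset.prod_range_succ' _ (t + 1)]
    field_simp

lemma cantorSum_lt_one {q E : ℕ → ℕ} (hq : IsBasic q) (hE : ∀ n, E n ≤ q n - 2) :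
    cantorSum q E < 1 := by
  have h := mul_cantorSum hq hE
  have h1 : cantorSum (fun i => q (i + 1)) (fun i => E (i + 1)) ≤ 1 :=
    cantorSum_le_one (fun i => hq (i + 1)) fun i => hE (i + 1)
  have hq0 : (2 : ℝ) ≤ q 0 := by exact_mod_cast hq 0
  have hE0 : (E 0 : ℝ) + 2 ≤ q 0 := by
    have h1 := hE 0
    have h2 := hq 0
    exact_mod_cast (by omega : E 0 + 2 ≤ q 0)
  by_contra! hc
  nlinarith

lemma TQ_cantorSum {q E : ℕ → ℕ} (hq : IsBasic q) (hE : ∀ n, E n ≤ q n - 2) (n : ℕ) :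
    TQ q n (cantorSum q E) = cantorSum (fun i => q (i + n)) (fun i => E (i + n)) := by
  induction n with
  | zero =>
    simp only [TQ, qprod, Finset.range_zero, Finset.prod_empty, one_mul, add_zero]
    exact Int.fract_eq_self.2 ⟨cantorSum_nonneg hq, cantorSum_lt_one hq hE⟩
  | succ n ih =>
    have hm := mul_cantorSum (q := fun i => q (i + n)) (E := fun i => E (i + n))
      (fun i => hq (i + n)) fun i => hE (i + n)
    simp only [zero_add, add_assoc, add_comm 1 n] at hm
    rw [← ih] at hm
    have hfl := Int.floor_add_fract (qprod q n * cantorSum q E)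
    rw [TQ, Int.fract_eq_iff]
    refine ⟨cantorSum_nonneg fun i => hq _, cantorSum_lt_one (fun i => hq _) fun i => hE _,
      q n * ⌊qprod q n * cantorSum q E⌋ + E n, ?_⟩
    have : qprod q (n + 1) = q n * qprod q n := by
      rw [qprod, Finset.prod_range_succ, mul_comm, qprod]
    rw [TQ] at hm
    rw [this, mul_assoc]
    push_cast
    linear_combination hm - (q n : ℝ) * hfl

theorem qdigit_cantorSum {q E : ℕ → ℕ} (hq : IsBasic q) (hE : ∀ n, E n ≤ q n - 2) (n : ℕ) :
    qdigit q (cantorSum q E) n = E n := by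
  have hm := mul_cantorSum (q := fun i => q (i + n)) (E := fun i => E (i + n))
    (fun i => hq (i + n)) fun i => hE (i + n)
  simp only [zero_add, add_assoc, add_comm 1 n] at hm
  rw [qdigit, TQ_cantorSum hq hE, hm]
  rw [Nat.floor_eq_iff (add_nonneg (Nat.cast_nonneg _) (cantorSum_nonneg fun i => hq _))]
  exact ⟨le_add_of_nonneg_right (cantorSum_nonneg fun i => hq _),
    add_lt_add_right (cantorSum_lt_one (fun i => hq _) fun i => hE _) _⟩

/-! ### Slowly growing level functions and allocation of objects to time slots -/

lemma exists_level {P : ℕ → ℕ → Prop} (h0 : ∀ n, P 0 n) (h : ∀ i, ∀ᶠ n in atTop, P i n) :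
    ∃ lev : ℕ → ℕ, Monotone lev ∧ Tendsto lev atTop atTop ∧ ∀ n, P (lev n) n := by
  refine ⟨fun n => Nat.findGreatest (fun i => ∀ n' ≥ n, P i n') n, ?_, ?_, ?_⟩
  · intro a b hab
    exact Nat.findGreatest_mono (fun i hi n' hn' => hi n' (hab.trans hn')) hab
  · refine tendsto_atTop.2 fun i => ?_
    obtain ⟨N, hN⟩ := eventually_atTop.1 (h i)
    filter_upwards [eventually_ge_atTop N, eventually_ge_atTop i] with n hn hi
    exact Nat.le_findGreatest hi fun n' hn' => hN n' (hn.trans hn')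
  · intro n
    exact Nat.findGreatest_spec (P := fun i => ∀ n' ≥ n, P i n') (Nat.zero_le n)
      (fun n' _ => h0 n') n le_rfl

/-- If objects accumulate demand at a rate bounded by the rate of available slots, then the slots
can be filled so that the total unmet demand stays bounded by the number of active objects. -/
lemma exists_allocation {α : Type*} [DecidableEq α] {A : ℕ → Finset α} (hA : Monotone A) {z : α}
    (hz : ∀ N, z ∉ A N) {lev : ℕ → ℕ} (hlev : Monotone lev) {H : ℕ → ℕ} (hH : ∀ N, 0 < H N)
    {e : ℕ → α → ℝ} (he : ∀ n w, 0 ≤ e n w) (hsupp : ∀ n w, w ∉ A (lev n) → e n w = 0)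
    (hmass : ∀ n, ∑ w ∈ A (lev n), e n w ≤ 1 / H (lev n)) :
    ∃ W : ℕ → α, (∀ n, W n = z ∨ H (lev n) ∣ n ∧ W n ∈ A (lev n)) ∧
      (∀ n, ∀ w ≠ z, ((∑ i ∈ range n, if W i = w then 1 else 0 : ℕ) : ℝ) ≤
        ∑ i ∈ range n, e i w) ∧
      ∀ n, ∑ w ∈ A (lev n), (∑ i ∈ range n, e i w -
        ((∑ i ∈ range n, if W i = w then 1 else 0 : ℕ) : ℝ)) ≤
          (A (lev n)).card + lev n + 1 := by
  let T : ℕ → α → ℝ := fun n w => ∑ i ∈ range n, e i w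
  have hT0 : ∀ w, T 0 w = 0 := fun w => Finset.sum_range_zero _
  let pick : ℕ → (α → ℕ) → α := fun n c =>
    if h : H (lev n) ∣ n ∧ ∃ w, w ≠ z ∧ 1 ≤ T n w - c w then h.2.choose else z
  obtain ⟨cnt, hcnt0, hcnts⟩ : ∃ cnt : ℕ → α → ℕ, (∀ w, cnt 0 w = 0) ∧
      ∀ n w, cnt (n + 1) w = cnt n w + if pick n (cnt n) = w then 1 else 0 :=
    ⟨fun n => Nat.rec (fun _ => 0) (fun n c w => c w + if pick n c = w then 1 else 0) n,
      fun _ => rfl, fun _ _ => rfl⟩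
  let W : ℕ → α := fun n => pick n (cnt n)
  have hcnt : ∀ n w, cnt n w = ∑ i ∈ range n, if W i = w then 1 else 0 := by
    intro n w
    induction n with
    | zero => exact hcnt0 w
    | succ n ih => rw [Finset.sum_range_succ, ← ih, hcnts]
  have hTs : ∀ n w, T (n + 1) w = T n w + e n w := fun n w => Finset.sum_range_succ _ _
  have hTA : ∀ n w, w ∉ A (lev n) → T n w = 0 := fun n w hw =>
    Finset.sum_eq_zero fun i hi => hsupp i w fun h =>
      hw (hA (hlev (Finset.mem_range.1 hi).le) h)
  have hpick : ∀ n, W n ≠ z → H (lev n) ∣ n ∧ 1 ≤ T n (W n) - (cnt n (W n) : ℝ) := by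
    intro n hn
    by_cases h : H (lev n) ∣ n ∧ ∃ w, w ≠ z ∧ 1 ≤ T n w - cnt n w
    · have : W n = h.2.choose := dif_pos h
      rw [this]
      exact ⟨h.1, h.2.choose_spec.2⟩
    · exact absurd (dif_neg h) hn
  have hpick' : ∀ n, H (lev n) ∣ n → W n = z → ∀ w ≠ z, T n w - cnt n w < 1 := by
    intro n hn hW w hw
    by_contra! hc
    have h : H (lev n) ∣ n ∧ ∃ w, w ≠ z ∧ 1 ≤ T n w - cnt n w := ⟨hn, w, hw, hc⟩
    have : W n = h.2.choose := dif_pos h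
    exact h.2.choose_spec.1 (this.symm.trans hW)
  have hWA : ∀ n, W n ≠ z → W n ∈ A (lev n) := by
    intro n hn
    by_contra hc
    have h1 := (hpick n hn).2
    rw [hTA n _ hc] at h1
    have : (0 : ℝ) ≤ cnt n (W n) := Nat.cast_nonneg _
    linarith
  have hcs : ∀ n w, (cnt (n + 1) w : ℝ) = cnt n w + if W n = w then 1 else 0 := by
    intro n w
    simp only [hcnt, Finset.sum_range_succ]
    push_cast
    rfl
  have hle : ∀ n, ∀ w ≠ z, (cnt n w : ℝ) ≤ T n w := by
    intro n w hw
    induction n with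
    | zero => rw [hcnt0, hT0, Nat.cast_zero]
    | succ n ih =>
      rw [hcs, hTs]
      have := he n w
      split_ifs with h
      · have h1 := (hpick n (h ▸ hw)).2
        rw [h] at h1
        linarith
      · linarith
  have main : ∀ n, ∑ w ∈ A (lev n), (T n w - cnt n w) ≤ (A (lev n)).card + lev n +
      if H (lev n) ∣ n then 1 else ((n % H (lev n) : ℕ) : ℝ) / H (lev n) := by
    intro n
    induction n with
    | zero =>
      rw [Finset.sum_eq_zero fun w _ => by rw [hT0, hcnt0, Nat.cast_zero, sub_zero]]
      refine add_nonneg (add_nonneg (Nat.cast_nonneg _) (Nat.cast_nonneg _)) ?_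
      split_ifs
      exacts [zero_le_one, div_nonneg (Nat.cast_nonneg _) (Nat.cast_nonneg _)]
    | succ n ih =>
      set h := H (lev n) with hh
      have hpos : (0 : ℝ) < h := by exact_mod_cast hH (lev n)
      have hstep : ∑ w ∈ A (lev n), (T (n + 1) w - cnt (n + 1) w) ≤ (A (lev n)).card + lev n +
          if h ∣ n + 1 then 1 else (((n + 1) % h : ℕ) : ℝ) / h := by
        have hsplit : ∑ w ∈ A (lev n), (T (n + 1) w - cnt (n + 1) w) =
            ∑ w ∈ A (lev n), (T n w - cnt n w) + ∑ w ∈ A (lev n), e n w -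
              ∑ w ∈ A (lev n), (if W n = w then 1 else 0 : ℝ) := by
          rw [← Finset.sum_add_distrib, ← Finset.sum_sub_distrib]
          refine Finset.sum_congr rfl fun w _ => ?_
          rw [hcs, hTs]
          ring
        have hm := hmass n
        have hmod : n % h < h := Nat.mod_lt _ (hH _)
        by_cases hd : h ∣ n
        · rw [if_pos hd] at ih
          have hred : ∑ w ∈ A (lev n), (T n w - cnt n w) -
              ∑ w ∈ A (lev n), (if W n = w then 1 else 0 : ℝ) ≤ (A (lev n)).card + lev n := by
            by_cases hW : W n = z
            · have h1 : ∑ w ∈ A (lev n), (T n w - cnt n w) ≤ ∑ w ∈ A (lev n), (1 : ℝ) :=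
                Finset.sum_le_sum fun w hw =>
                  (hpick' n hd hW w fun hwz => hz _ (hwz ▸ hw)).le
              have h2 : (0 : ℝ) ≤ ∑ w ∈ A (lev n), (if W n = w then 1 else 0 : ℝ) :=
                Finset.sum_nonneg fun w _ => by split_ifs <;> norm_num
              have h3 : (0 : ℝ) ≤ lev n := Nat.cast_nonneg _
              simp only [Finset.sum_const, nsmul_eq_mul, mul_one] at h1
              linarith
            · rw [Finset.sum_ite_eq, if_pos (hWA n hW)]
              linarith
          have hadd : 1 / (h : ℝ) ≤ if h ∣ n + 1 then 1 else (((n + 1) % h : ℕ) : ℝ) / h := by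
            split_ifs with hd'
            · rw [div_le_one hpos]
              exact_mod_cast hH (lev n)
            · gcongr
              exact_mod_cast Nat.pos_of_ne_zero fun h0 => hd' (Nat.dvd_of_mod_eq_zero h0)
          linarith
        · rw [if_neg hd] at ih
          have h2 : (0 : ℝ) ≤ ∑ w ∈ A (lev n), (if W n = w then 1 else 0 : ℝ) :=
            Finset.sum_nonneg fun w _ => by split_ifs <;> norm_num
          have hadd : ((n % h : ℕ) : ℝ) / h + 1 / h ≤
              if h ∣ n + 1 then 1 else (((n + 1) % h : ℕ) : ℝ) / h := by
            rw [← add_div]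
            split_ifs with hd'
            · rw [div_le_one hpos]
              exact_mod_cast hmod
            · gcongr
              have : (n + 1) % h = n % h + 1 := by
                rw [Nat.add_mod]
                rcases Nat.lt_or_ge 1 h with h1 | h1
                · rw [Nat.mod_eq_of_lt h1]
                  refine Nat.mod_eq_of_lt (lt_of_le_of_ne hmod fun heq => hd' ?_)
                  refine Nat.dvd_of_mod_eq_zero ?_
                  rw [Nat.add_mod, Nat.mod_eq_of_lt h1, heq, Nat.mod_self]
                · exact absurd (by rw [le_antisymm h1 (hH _)]; exact one_dvd _) hd
              rw [this]
              push_cast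
              exact le_rfl
          linarith
      rcases eq_or_lt_of_le (hlev n.le_succ) with heq | hlt
      · rw [Nat.succ_eq_add_one] at heq
        rw [← heq]
        exact hstep
      · have hsub : ∑ w ∈ A (lev (n + 1)), (T (n + 1) w - cnt (n + 1) w) =
            ∑ w ∈ A (lev n), (T (n + 1) w - cnt (n + 1) w) := by
          refine (Finset.sum_subset (hA hlt.le) fun w hw hw' => ?_).symm
          have h0 : T (n + 1) w = 0 := by rw [hTs, hTA n w hw', hsupp n w hw', add_zero]
          have h1 := hle (n + 1) w fun hwz => hz _ (hwz ▸ hw)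
          have h2 : (0 : ℝ) ≤ cnt (n + 1) w := Nat.cast_nonneg _
          linarith
        rw [hsub]
        have hc : ((A (lev n)).card : ℝ) ≤ (A (lev (n + 1))).card := by
          exact_mod_cast Finset.card_le_card (hA hlt.le)
        have hl : (lev n : ℝ) + 1 ≤ lev (n + 1) := by exact_mod_cast hlt
        have h1 : (if h ∣ n + 1 then 1 else (((n + 1) % h : ℕ) : ℝ) / h) ≤ 1 := by
          split_ifs
          · exact le_rfl
          · rw [div_le_one hpos]
            exact_mod_cast (Nat.mod_lt _ (hH _)).le
        have h2 : (0 : ℝ) ≤ if H (lev (n + 1)) ∣ n + 1 then 1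
            else (((n + 1) % H (lev (n + 1)) : ℕ) : ℝ) / H (lev (n + 1)) := by
          split_ifs
          exacts [zero_le_one, div_nonneg (Nat.cast_nonneg _) (Nat.cast_nonneg _)]
        linarith
  refine ⟨W, fun n => ?_, fun n w hw => ?_, fun n => ?_⟩
  · by_cases h : W n = z
    · exact Or.inl h
    · exact Or.inr ⟨(hpick n h).1, hWA n h⟩
  · rw [← hcnt]
    exact hle n w hw
  · simp only [← hcnt]
    refine (main n).trans (add_le_add le_rfl ?_)
    split_ifs
    · exact le_rfl
    · rw [div_le_one (by exact_mod_cast hH _)]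
      exact_mod_cast (Nat.mod_lt _ (hH _)).le

/-! ### Words, layouts of words among filler digits, and pattern counts -/

/-- A finite word over the alphabet `ℕ`. -/
abbrev Word := (ℓ : ℕ) × (Fin ℓ → ℕ)

/-- The letter of `w` at position `p`, if there is one. -/
def Word.letter (w : Word) (p : ℕ) : Option ℕ :=
  if h : p < w.1 then some (w.2 ⟨p, h⟩) else none

lemma Word.lt_of_letter {w : Word} {p x : ℕ} (h : w.letter p = some x) : p < w.1 := by
  by_contra hc
  simp [Word.letter, hc] at h

/-- The nonempty words of length at most `N` over the alphabet `{0, …, N - 1}`. -/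
def words (N : ℕ) : Finset Word :=
  (Finset.Icc 1 N).sigma fun _ => Fintype.piFinset fun _ => Finset.range N

lemma mem_words {N : ℕ} {w : Word} :
    w ∈ words N ↔ (1 ≤ w.1 ∧ w.1 ≤ N) ∧ ∀ p, w.2 p < N := by
  simp [words]

lemma words_mono : Monotone words := by
  intro M N h w hw
  rw [mem_words] at hw ⊢
  exact ⟨⟨hw.1.1, hw.1.2.trans h⟩, fun p => (hw.2 p).trans_le h⟩

/-- Words of level `N` are placed only at multiples of `spacing N`. -/
def spacing (N : ℕ) : ℕ := (2 * N + 1).factorial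

/-- The words `W i`, written at the positions `i`, keep away from each other, and their starting
points are eventually divisible by every positive integer. -/
structure IsLayout (lev : ℕ → ℕ) (W : ℕ → Word) : Prop where
  mono : Monotone lev
  tendsto : Tendsto lev atTop atTop
  len_le : ∀ i, (W i).1 ≤ lev i
  dvd : ∀ i, (W i).1 ≠ 0 → spacing (lev i) ∣ i

/-- The digit at position `p` in the layout `W`, with filler digit `q p - 2` outside all words. -/
noncomputable def layoutDigit (q : ℕ → ℕ) (W : ℕ → Word) (p : ℕ) : ℕ :=
  if h : ∃ x, ∃ i ≤ p, (W i).letter (p - i) = some x then h.choose else q p - 2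

/-- The number of positions `p < n` with `p ≡ r (mod m)` at which the block `B` occurs in `E`
along the progression of difference `d`. -/
noncomputable def digitCount (E : ℕ → ℕ) (d m r : ℕ) {k : ℕ} (B : Fin k → ℕ) (n : ℕ) : ℕ :=
  ((Finset.range n).filter fun p => p % m = r ∧ ∀ j : Fin k, E (p + d * j) = B j).card

/-- The number of positions `o ≡ r (mod m)` at which the block `B` occurs in the word `w`
along the progression of difference `d`. -/
noncomputable def patCount (d m r : ℕ) {k : ℕ} (B : Fin k → ℕ) (w : Word) : ℕ :=
  ((Finset.range w.1).filter fun o =>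
    o % m = r ∧ ∀ j : Fin k, w.letter (o + d * j) = some (B j)).card

lemma patCount_le (d m r : ℕ) {k : ℕ} (B : Fin k → ℕ) (w : Word) : patCount d m r B w ≤ w.1 :=
  (Finset.card_filter_le _ _).trans (Finset.card_range _).le

namespace IsLayout

variable {lev : ℕ → ℕ} {W : ℕ → Word}

lemma gap (h : IsLayout lev W) {i i' : ℕ} (hi : (W i).1 ≠ 0) (hi' : (W i').1 ≠ 0)
    (hlt : i < i') : i + 2 * lev i + 1 ≤ i' := by
  have h1 := h.dvd i hi
  have h2 : spacing (lev i) ∣ i' := by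
    refine dvd_trans (Nat.factorial_dvd_factorial ?_) (h.dvd i' hi')
    have := h.mono hlt.le
    omega
  have h3 : spacing (lev i) ≤ i' - i := Nat.le_of_dvd (by omega) (Nat.dvd_sub h2 h1)
  have h4 : 2 * lev i + 1 ≤ spacing (lev i) := Nat.self_le_factorial _
  omega

lemma eq_of_close (h : IsLayout lev W) {i i' p d x x' : ℕ} (hi : i ≤ p)
    (hx : (W i).letter (p - i) = some x) (hi' : i' ≤ p + d)
    (hx' : (W i').letter (p + d - i') = some x') (hd : d ≤ lev i) : i = i' := by
  have h1 := Word.lt_of_letter hx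
  have h2 := Word.lt_of_letter hx'
  have h3 := h.len_le i
  have h4 := h.len_le i'
  rcases lt_trichotomy i i' with hlt | heq | hlt
  · have := h.gap (by omega) (by omega) hlt
    omega
  · exact heq
  · have := h.gap (by omega) (by omega) hlt
    omega

lemma layoutDigit_eq (h : IsLayout lev W) (q : ℕ → ℕ) {i o x : ℕ}
    (hx : (W i).letter o = some x) : layoutDigit q W (i + o) = x := by
  have hx0 : (W i).letter (i + o - i) = some x := by rwa [Nat.add_sub_cancel_left]
  have hex : ∃ x, ∃ i' ≤ i + o, (W i').letter (i + o - i') = some x :=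
    ⟨x, i, Nat.le_add_right _ _, hx0⟩
  rw [layoutDigit, dif_pos hex]
  obtain ⟨i', hi', hx'⟩ := hex.choose_spec
  have := h.eq_of_close (d := 0) (Nat.le_add_right i o) hx0 hi' hx' (Nat.zero_le _)
  subst this
  exact Option.some_injective _ (hx'.symm.trans hx0)

lemma exists_of_layoutDigit_ne {q : ℕ → ℕ} {p : ℕ} (h : layoutDigit q W p ≠ q p - 2) :
    ∃ i ≤ p, (W i).letter (p - i) = some (layoutDigit q W p) := by
  by_cases hex : ∃ x, ∃ i ≤ p, (W i).letter (p - i) = some x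
  · rw [layoutDigit, dif_pos hex]
    exact hex.choose_spec
  · exact absurd (dif_neg hex) h

lemma layoutDigit_le (h : IsLayout lev W) {q : ℕ → ℕ}
    (hlev : ∀ n, lev n + 1 ≤ q n) (hW : ∀ i p, (W i).2 p < lev i) (p : ℕ) :
    layoutDigit q W p ≤ q p - 2 := by
  by_cases hne : layoutDigit q W p = q p - 2
  · exact hne.le
  · obtain ⟨i, hi, hx⟩ := exists_of_layoutDigit_ne hne
    have hlt := Word.lt_of_letter hx
    rw [Word.letter, dif_pos hlt] at hx
    have h1 := Option.some_injective _ hx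
    have h2 := hW i ⟨p - i, hlt⟩
    have h3 := h.mono hi
    have h4 := hlev p
    omega

lemma eventually_occurs (h : IsLayout lev W) {q : ℕ → ℕ} (hq : Tendsto q atTop atTop)
    (d : ℕ) {m : ℕ} (hm : 0 < m) {k : ℕ} (hk : 0 < k) (B : Fin k → ℕ) :
    ∃ P, ∀ p ≥ P, (∀ j : Fin k, layoutDigit q W (p + d * j) = B j) →
      ∃ i ≤ p, m ∣ i ∧ p - i < (W i).1 ∧
        ∀ j : Fin k, (W i).letter (p - i + d * j) = some (B j) := by
  obtain ⟨X, hX⟩ := eventually_atTop.1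
    ((h.tendsto.eventually_ge_atTop d).and (h.tendsto.eventually_ge_atTop m))
  obtain ⟨Y, hY⟩ := eventually_atTop.1
    (hq.eventually_ge_atTop (Finset.univ.sup B + 3))
  refine ⟨max Y (X + lev X), fun p hp hB => ?_⟩
  have hcov : ∀ j : Fin k, ∃ i ≤ p + d * j, (W i).letter (p + d * j - i) = some (B j) := by
    intro j
    have h1 := hY (p + d * j) (((le_max_left _ _).trans hp).trans (Nat.le_add_right _ _))
    have h2 : B j ≤ Finset.univ.sup B := Finset.le_sup (Finset.mem_univ j)
    have := exists_of_layoutDigit_ne (W := W) (q := q) (p := p + d * j) (by rw [hB j]; omega)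
    rwa [hB j] at this
  obtain ⟨i, hi, hx⟩ := hcov ⟨0, hk⟩
  simp only [mul_zero, add_zero] at hi hx
  have hlt := Word.lt_of_letter hx
  have hiX : X ≤ i := by
    by_contra! hc
    have h1 := h.mono hc.le
    have h2 := h.len_le i
    have h3 := (le_max_right _ _).trans hp
    omega
  refine ⟨i, hi, ?_, hlt, ?_⟩
  · refine (Nat.dvd_factorial hm ?_).trans (h.dvd i (by omega))
    have := (hX i hiX).2
    omega
  · rintro ⟨j, hj⟩
    induction j with
    | zero => simpa using hx
    | succ j ih =>
      obtain ⟨i', hi', hx'⟩ := hcov ⟨j + 1, hj⟩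
      have h1 := ih (by omega)
      simp only at h1 hi' hx' ⊢
      rw [mul_add, mul_one, ← add_assoc] at hi' hx'
      have : i = i' := h.eq_of_close (p := p + d * j) (by omega)
        (by rwa [show p + d * j - i = p - i + d * j by omega]) hi' hx' (hX i hiX).1
      subst this
      rw [← hx']
      congr 1
      rw [mul_add]
      omega

lemma exists_digitCount_le (h : IsLayout lev W) {q : ℕ → ℕ} (hq : Tendsto q atTop atTop)
    (d : ℕ) {m : ℕ} (hm : 0 < m) (r : ℕ) {k : ℕ} (hk : 0 < k) (B : Fin k → ℕ) :
    ∃ C, ∀ n, digitCount (layoutDigit q W) d m r B n ≤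
      ∑ i ∈ range n, patCount d m r B (W i) + C := by
  obtain ⟨P, hP⟩ := h.eventually_occurs hq d hm hk B
  refine ⟨P, fun n => ?_⟩
  have hsub : ((Finset.range n).filter fun p =>
      p % m = r ∧ ∀ j : Fin k, layoutDigit q W (p + d * j) = B j) ⊆
      ((range n).biUnion fun i => ((Finset.range (W i).1).filter fun o =>
        o % m = r ∧ ∀ j : Fin k, (W i).letter (o + d * j) = some (B j)).image (i + ·)) ∪
      range P := by
    intro p hp
    simp only [Finset.mem_filter, Finset.mem_range] at hp
    obtain ⟨hpn, hpr, hpB⟩ := hp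
    rw [Finset.mem_union]
    by_cases hpP : p < P
    · exact Or.inr (Finset.mem_range.2 hpP)
    · left
      obtain ⟨i, hi, ⟨c, rfl⟩, hlt, hocc⟩ := hP p (not_lt.1 hpP) hpB
      simp only [Finset.mem_biUnion, Finset.mem_image, Finset.mem_filter, Finset.mem_range]
      refine ⟨m * c, by omega, p - m * c, ⟨hlt, ?_, hocc⟩, by omega⟩
      rw [← hpr]
      conv_rhs => rw [← Nat.add_sub_cancel' hi, Nat.mul_add_mod]
  refine (Finset.card_le_card hsub).trans ((Finset.card_union_le _ _).trans ?_)
  rw [Finset.card_range]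
  exact Nat.add_le_add_right
    (Finset.card_biUnion_le.trans (Finset.sum_le_sum fun i _ => Finset.card_image_le)) _

lemma exists_le_digitCount (h : IsLayout lev W) (q : ℕ → ℕ)
    (d : ℕ) {m : ℕ} (hm : 0 < m) (r : ℕ) {k : ℕ} (B : Fin k → ℕ) :
    ∃ C, ∀ n, ∑ i ∈ range n, patCount d m r B (W i) ≤
      digitCount (layoutDigit q W) d m r B n + C + lev n := by
  obtain ⟨X, hX⟩ := eventually_atTop.1 (h.tendsto.eventually_ge_atTop m)
  refine ⟨∑ i ∈ range X, patCount d m r B (W i), fun n => ?_⟩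
  have hsplit : ∑ i ∈ range n, patCount d m r B (W i) ≤
      ∑ i ∈ range X, patCount d m r B (W i) +
        ∑ i ∈ (range n).filter (X ≤ ·), patCount d m r B (W i) := by
    rw [← Finset.sum_filter_add_sum_filter_not (range n) (· < X)]
    simp only [not_lt]
    refine Nat.add_le_add_right (Finset.sum_le_sum_of_subset fun i hi => ?_) _
    exact Finset.mem_range.2 (Finset.mem_filter.1 hi).2
  have htail : ∑ i ∈ (range n).filter (X ≤ ·), patCount d m r B (W i) ≤
      digitCount (layoutDigit q W) d m r B (n + lev n) := by
    have hcard : ∀ i, patCount d m r B (W i) =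
        (((Finset.range (W i).1).filter fun o => o % m = r ∧
          ∀ j : Fin k, (W i).letter (o + d * j) = some (B j)).image (i + ·)).card := fun i =>
      (Finset.card_image_of_injective _ (add_right_injective i)).symm
    rw [Finset.sum_congr rfl fun i _ => hcard i, ← Finset.card_biUnion]
    · refine Finset.card_le_card fun p hp => ?_
      simp only [Finset.mem_biUnion, Finset.mem_image, Finset.mem_filter,
        Finset.mem_range] at hp ⊢
      obtain ⟨i, ⟨hin, hXi⟩, o, ⟨ho, hor, hocc⟩, rfl⟩ := hp
      have h1 := h.len_le i
      have h2 := h.mono hin.le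
      refine ⟨by omega, ?_, fun j => ?_⟩
      · have : m ∣ i := by
          refine (Nat.dvd_factorial hm ?_).trans (h.dvd i (by omega))
          have := hX i hXi
          omega
        obtain ⟨c, rfl⟩ := this
        rw [Nat.mul_add_mod, hor]
      · rw [add_assoc]
        exact h.layoutDigit_eq q (hocc j)
    · intro i _ i' _ hne
      rw [Function.onFun, Finset.disjoint_left]
      intro p hp hp'
      simp only [Finset.mem_image, Finset.mem_filter, Finset.mem_range] at hp hp'
      obtain ⟨o, ⟨ho, -⟩, rfl⟩ := hp
      obtain ⟨o', ⟨ho', -⟩, heq⟩ := hp'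
      have h1 := h.len_le i
      have h2 := h.len_le i'
      rcases lt_or_gt_of_ne hne with hlt | hlt
      · have := h.gap (by omega) (by omega) hlt
        omega
      · have := h.gap (by omega) (by omega) hlt
        omega
  have hext : digitCount (layoutDigit q W) d m r B (n + lev n) ≤
      digitCount (layoutDigit q W) d m r B n + lev n := by
    unfold digitCount
    simp only [Finset.range_eq_Ico]
    rw [← Finset.Ico_union_Ico_eq_Ico (Nat.zero_le n)
      (Nat.le_add_right n (lev n)), Finset.filter_union]
    refine (Finset.card_union_le _ _).trans (Nat.add_le_add_left ?_ _)
    exact (Finset.card_filter_le _ _).trans (by simp)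
  omega

end IsLayout

lemma card_occurrences {N ℓ o d k : ℕ} (hd : 0 < d) {B : Fin k → ℕ} (hB : ∀ j, B j < N) :
    ((Fintype.piFinset fun _ : Fin ℓ => Finset.range N).filter fun v =>
      ∀ j : Fin k, Word.letter ⟨ℓ, v⟩ (o + d * j) = some (B j)).card =
    if ∀ j : Fin k, o + d * j < ℓ then N ^ (ℓ - k) else 0 := by
  split_ifs with hlt
  · have heq : ((Fintype.piFinset fun _ : Fin ℓ => Finset.range N).filter fun v =>
        ∀ j : Fin k, Word.letter ⟨ℓ, v⟩ (o + d * j) = some (B j)) =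
        Fintype.piFinset fun p : Fin ℓ => (Finset.range N).filter fun x =>
          ∀ j : Fin k, o + d * j = p → x = B j := by
      ext v
      simp only [Finset.mem_filter, Fintype.mem_piFinset, Word.letter, hlt, dif_pos,
        Option.some.injEq]
      refine ⟨fun h p => ⟨h.1 p, fun j hj => ?_⟩, fun h => ⟨fun p => (h p).1, fun j => ?_⟩⟩
      · rw [← h.2 j]
        congr 1
        exact Fin.ext hj.symm
      · exact (h ⟨o + d * j, hlt j⟩).2 j rfl
    have hfac : ∀ p : Fin ℓ, ((Finset.range N).filter fun x =>
        ∀ j : Fin k, o + d * j = p → x = B j).card =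
        if ∃ j : Fin k, o + d * j = p then 1 else N := by
      intro p
      split_ifs with hp
      · obtain ⟨j, hj⟩ := hp
        rw [Finset.card_eq_one]
        refine ⟨B j, Finset.eq_singleton_iff_unique_mem.2 ⟨?_, fun x hx => ?_⟩⟩
        · refine Finset.mem_filter.2 ⟨Finset.mem_range.2 (hB j), fun j' hj' => ?_⟩
          have : d * (j' : ℕ) = d * j := by omega
          rw [Fin.ext (Nat.eq_of_mul_eq_mul_left hd this)]
        · exact (Finset.mem_filter.1 hx).2 j hj
      · rw [Finset.filter_true_of_mem, Finset.card_range]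
        exact fun x _ j hj => absurd ⟨j, hj⟩ hp
    have hinj : Function.Injective fun j : Fin k => (⟨o + d * j, hlt j⟩ : Fin ℓ) := by
      intro j j' hj
      have : d * (j : ℕ) = d * j' := by
        have := congrArg Fin.val hj
        simp only at this
        omega
      exact Fin.ext (Nat.eq_of_mul_eq_mul_left hd this)
    have hcard : ((Finset.univ : Finset (Fin ℓ)).filter fun p : Fin ℓ =>
        ∃ j : Fin k, o + d * j = (p : ℕ)).card = k := by
      have : ((Finset.univ : Finset (Fin ℓ)).filter fun p : Fin ℓ =>
          ∃ j : Fin k, o + d * j = (p : ℕ)) =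
          Finset.univ.image fun j : Fin k => (⟨o + d * j, hlt j⟩ : Fin ℓ) := by
        ext p
        simp [Fin.ext_iff, eq_comm]
      rw [this, Finset.card_image_of_injective _ hinj, Finset.card_univ, Fintype.card_fin]
    rw [heq, Fintype.card_piFinset, Finset.prod_congr rfl fun p _ => hfac p, Finset.prod_ite,
      Finset.prod_const_one, one_mul, Finset.prod_const]
    congr 1
    have := Finset.card_filter_add_card_filter_not (s := (Finset.univ : Finset (Fin ℓ)))
      fun p => ∃ j : Fin k, o + d * j = (p : ℕ)
    rw [hcard, Finset.card_univ, Fintype.card_fin] at this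
    omega
  · rw [Finset.card_eq_zero, Finset.filter_eq_empty_iff]
    exact fun v _ hv => hlt fun j => Word.lt_of_letter (hv j)

lemma sum_patCount {N ℓ d m r k : ℕ} (hd : 0 < d) {B : Fin k → ℕ} (hB : ∀ j, B j < N) :
    ∑ v ∈ Fintype.piFinset fun _ : Fin ℓ => Finset.range N, patCount d m r B ⟨ℓ, v⟩ =
      ∑ o ∈ range ℓ, if o % m = r ∧ ∀ j : Fin k, o + d * j < ℓ then N ^ (ℓ - k) else 0 := by
  simp only [patCount, Finset.card_filter]
  rw [Finset.sum_comm]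
  refine Finset.sum_congr rfl fun o _ => ?_
  by_cases ho : o % m = r
  · have := card_occurrences (N := N) (ℓ := ℓ) (o := o) hd hB
    rw [Finset.card_filter] at this
    simpa only [ho, true_and] using this
  · simp [ho]

lemma sum_patCount_le {N ℓ k : ℕ} (hk : 0 < k) {B : Fin k → ℕ} (hB : ∀ j, B j < N) :
    ∑ v ∈ Fintype.piFinset fun _ : Fin ℓ => Finset.range N, patCount 1 1 0 B ⟨ℓ, v⟩ ≤
      if ℓ < k then 0 else if ℓ = k then 1 else ℓ * N ^ (ℓ - k) := by
  rw [sum_patCount one_pos hB]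
  have hlast : ∀ o, (∀ j : Fin k, o + 1 * (j : ℕ) < ℓ) → o + k ≤ ℓ := by
    intro o h
    have := h ⟨k - 1, by omega⟩
    simp only at this
    omega
  split_ifs with h1 h2
  · refine (Finset.sum_eq_zero fun o _ => if_neg fun h => ?_).le
    have := hlast o h.2
    omega
  · subst h2
    rw [Finset.sum_eq_single_of_mem 0 (Finset.mem_range.2 hk)]
    · split_ifs <;> simp
    · intro o _ ho
      refine if_neg fun h => ?_
      have := hlast o h.2
      omega
  · refine (Finset.sum_le_card_nsmul _ _ (N ^ (ℓ - k)) fun o _ => ?_).trans (by simp)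
    split_ifs <;> simp

/-- A word whose letters along the progression `r, r + d, r + 2 * d, …` spell out `B`. -/
lemma exists_patCount_pos (d m : ℕ) {r k : ℕ} (hr : r < m) (hd : 0 < d) (hk : 0 < k)
    (B : Fin k → ℕ) :
    ∃ w : Word, w.1 = r + d * (k - 1) + 1 ∧ 1 ≤ patCount d m r B w := by
  have hlt : ∀ j : Fin k, r + d * j < r + d * (k - 1) + 1 := by
    intro j
    have : d * (j : ℕ) ≤ d * (k - 1) := Nat.mul_le_mul_left _ (by omega)
    omega
  refine ⟨⟨r + d * (k - 1) + 1, fun p => if h : (p - r) / d < k then B ⟨(p - r) / d, h⟩ else 0⟩,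
    rfl, Finset.card_pos.2 ⟨r, ?_⟩⟩
  refine Finset.mem_filter.2 ⟨Finset.mem_range.2 (Nat.lt_succ_of_le (Nat.le_add_right _ _)),
    Nat.mod_eq_of_lt hr, fun j => ?_⟩
  rw [Word.letter, dif_pos (hlt j)]
  simp [Nat.mul_div_cancel_left _ hd]

lemma patCount_self {m k : ℕ} (hk : 0 < k) (B : Fin k → ℕ) :
    1 ≤ patCount 1 m 0 B ⟨k, B⟩ := by
  refine Finset.card_pos.2 ⟨0, Finset.mem_filter.2
    ⟨Finset.mem_range.2 hk, Nat.zero_mod m, fun j => ?_⟩⟩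
  simp [Word.letter]

lemma patCount_add_self_le {m r k : ℕ} (hr : 0 < r) (hk : 0 < k) (B : Fin k → ℕ) (w : Word) :
    patCount 1 m r B w + (if w = ⟨k, B⟩ then 1 else 0) ≤ patCount 1 1 0 B w := by
  split_ifs with hw
  · subst hw
    refine Nat.succ_le_of_lt (Finset.card_lt_card ⟨fun o ho => ?_, fun hsub => ?_⟩)
    · rw [Finset.mem_filter] at ho ⊢
      exact ⟨ho.1, Nat.mod_one _, ho.2.2⟩
    · have h0 : 0 ∈ (Finset.range k).filter fun o => o % 1 = 0 ∧
          ∀ j : Fin k, Word.letter ⟨k, B⟩ (o + 1 * j) = some (B j) :=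
        Finset.mem_filter.2 ⟨Finset.mem_range.2 hk, rfl, fun j => by simp [Word.letter]⟩
      have := (Finset.mem_filter.1 (hsub h0)).2.1
      rw [Nat.zero_mod] at this
      omega
  · rw [add_zero]
    refine Finset.card_le_card fun o ho => ?_
    rw [Finset.mem_filter] at ho ⊢
    exact ⟨ho.1, Nat.mod_one _, ho.2.2⟩

/-! ### Balanced layouts -/

/-- The expected frequency at position `n` of a block of length `k`. -/
noncomputable def wt (q : ℕ → ℕ) (k n : ℕ) : ℝ := (∏ i ∈ Finset.range k, (q (n + i) : ℝ))⁻¹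

/-- The factor by which blocks of length `k` are to be over-represented. -/
noncomputable def excess (S : Set ℕ) (k : ℕ) : ℝ := if k ∈ S then 1 else 2

/-- The desired frequency of the word `w` at position `n`. -/
noncomputable def demand (q : ℕ → ℕ) (S : Set ℕ) (lev : ℕ → ℕ) (n : ℕ) (w : Word) : ℝ :=
  if w ∈ words (lev n) then excess S w.1 * wt q w.1 n else 0

/-- How large the basic sequence has to be before the level `N` may be used. -/
def growth (N : ℕ) : ℕ := N ^ 4 + 2 * N ^ 2 * spacing N + 2

/-- A bound on the discrepancies of pattern counts at level `N`. -/
def slack (N : ℕ) : ℕ := N * ((words N).card + N + 1) + N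

/-- A layout in which the number of occurrences of each word is close to the desired one. -/
structure IsBalanced (q : ℕ → ℕ) (S : Set ℕ) (lev : ℕ → ℕ) (W : ℕ → Word) : Prop
    extends IsLayout lev W where
  mem_words : ∀ i, (W i).1 = 0 ∨ W i ∈ words (lev i)
  growth_le : ∀ n, growth (lev n) ≤ q n
  slack_le : ∀ n k, 1 ≤ k → k ≤ lev n → (lev n * slack (lev n) : ℝ) ≤ Qsum q k n
  count_le : ∀ n (w : Word), w.1 ≠ 0 →
    ((∑ i ∈ range n, if W i = w then 1 else 0 : ℕ) : ℝ) ≤ ∑ i ∈ range n, demand q S lev i w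
  deficit_le : ∀ n, ∑ w ∈ words (lev n), (∑ i ∈ range n, demand q S lev i w -
    ((∑ i ∈ range n, if W i = w then 1 else 0 : ℕ) : ℝ)) ≤ (words (lev n)).card + lev n + 1

lemma one_le_excess (S : Set ℕ) (k : ℕ) : 1 ≤ excess S k := by
  unfold excess; split_ifs <;> norm_num

lemma excess_le_two (S : Set ℕ) (k : ℕ) : excess S k ≤ 2 := by
  unfold excess; split_ifs <;> norm_num

lemma wt_pos {q : ℕ → ℕ} (hq : IsBasic q) (k n : ℕ) : 0 < wt q k n :=
  inv_pos.2 (Finset.prod_pos fun i _ => by have := hq (n + i); positivity)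

lemma wt_add_le {q : ℕ → ℕ} (hq : IsBasic q) (hmono : Monotone q) (k p n : ℕ) :
    wt q (k + p) n ≤ wt q k n * ((q n : ℝ)⁻¹) ^ p := by
  induction p with
  | zero => simp
  | succ p ih =>
    have hpos : (0 : ℝ) < q n := by have := hq n; positivity
    have hle : (q n : ℝ) ≤ q (n + (k + p)) := by exact_mod_cast hmono (Nat.le_add_right _ _)
    have h1 : wt q (k + (p + 1)) n = wt q (k + p) n * (q (n + (k + p)) : ℝ)⁻¹ := by
      rw [wt, ← add_assoc, Finset.prod_range_succ, mul_inv, wt]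
    rw [h1, pow_succ, ← mul_assoc]
    gcongr
    exact mul_nonneg (wt_pos hq _ _).le (by positivity)

lemma wt_le_pow {q : ℕ → ℕ} (hq : IsBasic q) (hmono : Monotone q) (k n : ℕ) :
    wt q k n ≤ ((q n : ℝ)⁻¹) ^ k := by
  simpa [wt] using wt_add_le hq hmono 0 k n

lemma wt_antitone {q : ℕ → ℕ} (hq : IsBasic q) (hmono : Monotone q) (k : ℕ) :
    Antitone (wt q k) := by
  intro a b hab
  refine inv_anti₀ (Finset.prod_pos fun i _ => by have := hq (a + i); positivity) ?_
  refine Finset.prod_le_prod (fun _ _ => Nat.cast_nonneg _) fun i _ => ?_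
  exact_mod_cast hmono (Nat.add_le_add_right hab i)

lemma demand_nonneg {q : ℕ → ℕ} (hq : IsBasic q) (S : Set ℕ) (lev : ℕ → ℕ) (n : ℕ) (w : Word) :
    0 ≤ demand q S lev n w := by
  unfold demand
  split_ifs
  · exact mul_nonneg (zero_le_one.trans (one_le_excess _ _)) (wt_pos hq _ _).le
  · exact le_rfl

lemma sum_demand {q : ℕ → ℕ} (S : Set ℕ) (lev : ℕ → ℕ) (f : Word → ℕ) (n : ℕ) :
    ∑ w ∈ words (lev n), (f w : ℝ) * demand q S lev n w =
      ∑ ℓ ∈ Finset.Icc 1 (lev n), excess S ℓ * wt q ℓ n *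
        ((∑ v ∈ Fintype.piFinset fun _ : Fin ℓ => Finset.range (lev n), f ⟨ℓ, v⟩ : ℕ) : ℝ) := by
  have h1 : ∑ w ∈ words (lev n), (f w : ℝ) * demand q S lev n w =
      ∑ w ∈ words (lev n), (f w : ℝ) * (excess S w.1 * wt q w.1 n) :=
    Finset.sum_congr rfl fun w hw => by rw [demand, if_pos hw]
  rw [h1, words, Finset.sum_sigma]
  refine Finset.sum_congr rfl fun ℓ _ => ?_
  rw [Nat.cast_sum, Finset.mul_sum]
  exact Finset.sum_congr rfl fun v _ => mul_comm _ _

lemma sum_demand_le {q : ℕ → ℕ} (hq : IsBasic q) (hmono : Monotone q) (S : Set ℕ)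
    {lev : ℕ → ℕ} {n : ℕ} (hg : growth (lev n) ≤ q n) :
    ∑ w ∈ words (lev n), demand q S lev n w ≤ 1 / spacing (lev n) := by
  have h := sum_demand (q := q) S lev (fun _ => 1) n
  simp only [Nat.cast_one, one_mul, Finset.sum_const, Fintype.card_piFinset, Finset.card_range,
    Finset.prod_const, Finset.card_univ, Fintype.card_fin, smul_eq_mul, mul_one] at h
  rw [h]
  set N := lev n
  have hqpos : (0 : ℝ) < q n := by have := hq n; positivity
  have hspos : (0 : ℝ) < spacing N := by exact_mod_cast Nat.factorial_pos _
  have hg1 : (N : ℝ) ^ 4 + 2 * (N : ℝ) ^ 2 * spacing N + 2 ≤ q n := by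
    exact_mod_cast hg
  have hNq : (N : ℝ) * (q n : ℝ)⁻¹ ≤ 1 := by
    rw [← div_eq_mul_inv, div_le_one hqpos]
    have : (N : ℝ) ≤ (N : ℝ) ^ 4 := by
      exact_mod_cast Nat.le_self_pow (by norm_num) N
    nlinarith [mul_nonneg (sq_nonneg (N : ℝ)) hspos.le]
  have hterm : ∀ ℓ ∈ Finset.Icc 1 N, excess S ℓ * wt q ℓ n * ((N ^ ℓ : ℕ) : ℝ) ≤
      2 * ((N : ℝ) * (q n : ℝ)⁻¹) := by
    intro ℓ hℓ
    have h1 := (Finset.mem_Icc.1 hℓ).1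
    calc excess S ℓ * wt q ℓ n * ((N ^ ℓ : ℕ) : ℝ)
        ≤ 2 * ((q n : ℝ)⁻¹) ^ ℓ * ((N ^ ℓ : ℕ) : ℝ) := by
          gcongr
          · exact (wt_pos hq _ _).le
          · exact excess_le_two _ _
          · exact wt_le_pow hq hmono _ _
      _ = 2 * ((N : ℝ) * (q n : ℝ)⁻¹) ^ ℓ := by push_cast; rw [mul_pow]; ring
      _ ≤ 2 * ((N : ℝ) * (q n : ℝ)⁻¹) := by
          gcongr
          exact pow_le_of_le_one (by positivity) hNq (by omega)
  refine (Finset.sum_le_card_nsmul _ _ _ hterm).trans ?_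
  rw [Nat.card_Icc, nsmul_eq_mul, Nat.add_sub_cancel]
  rw [le_div_iff₀ hspos]
  have : (N : ℝ) * (2 * ((N : ℝ) * (q n : ℝ)⁻¹)) * spacing N =
      (2 * (N : ℝ) ^ 2 * spacing N) / q n := by
    rw [div_eq_mul_inv]; ring
  rw [this, div_le_one hqpos]
  nlinarith [sq_nonneg ((N : ℝ) ^ 2)]

theorem exists_isBalanced {q : ℕ → ℕ} (hq : IsBasic q) (hdiv : FullyDivergent q)
    (hmono : Monotone q) (hinf : InfiniteInLimit q) (S : Set ℕ) :
    ∃ lev W, IsBalanced q S lev W := by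
  obtain ⟨lev, hlev, htend, hP⟩ := exists_level
    (P := fun N n => growth N ≤ q n ∧ ∀ k ∈ Finset.Icc 1 N, (N * slack N : ℝ) ≤ Qsum q k n)
    (fun n => ⟨by simpa [growth] using hq n, by simp⟩) fun N => by
      refine (hinf.eventually_ge_atTop _).and ?_
      rw [Filter.eventually_all_finset]
      exact fun k hk => (hdiv k (Finset.mem_Icc.1 hk).1).eventually_ge_atTop _
  obtain ⟨W, hW, hcount, hdef⟩ := exists_allocation words_mono
    (z := (⟨0, Fin.elim0⟩ : Word)) (fun N h => by simp [mem_words] at h) hlev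
    (H := spacing) (fun N => Nat.factorial_pos _) (demand_nonneg hq S lev)
    (fun n w hw => if_neg hw) fun n => sum_demand_le hq hmono S (hP n).1
  refine ⟨lev, W, ⟨hlev, htend, fun i => ?_, fun i hi => ?_⟩, fun i => ?_, fun n => (hP n).1,
    fun n k h1 h2 => (hP n).2 k (Finset.mem_Icc.2 ⟨h1, h2⟩), fun n w hw => ?_, hdef⟩
  · rcases hW i with h | h
    · simp [h]
    · exact (mem_words.1 h.2).1.2
  · rcases hW i with h | h
    · simp [h] at hi
    · exact h.1
  · rcases hW i with h | h
    · simp [h]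
    · exact Or.inr h.2
  · exact hcount n w fun h => hw (by rw [h])

namespace IsBalanced

variable {q : ℕ → ℕ} {S : Set ℕ} {lev : ℕ → ℕ} {W : ℕ → Word}

lemma layoutDigit_le_sub_two (h : IsBalanced q S lev W) (p : ℕ) :
    layoutDigit q W p ≤ q p - 2 := by
  refine h.toIsLayout.layoutDigit_le (fun n => ?_) (fun i p => ?_) p
  · have h1 := h.growth_le n
    have h2 : lev n ≤ lev n ^ 4 := Nat.le_self_pow (by norm_num) _
    unfold growth at h1
    omega
  · rcases h.mem_words i with h0 | hw
    · exact absurd p.2 (by omega)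
    · exact (_root_.mem_words.1 hw).2 p

/-- The sum of a function over the placed words is close to its expected value. -/
lemma sum_le_expected (h : IsBalanced q S lev W) {f : Word → ℕ} (hf : ∀ w, f w ≤ w.1) (n : ℕ) :
    ((∑ i ∈ range n, f (W i) : ℕ) : ℝ) ≤
      ∑ i ∈ range n, ∑ w ∈ words (lev i), (f w : ℝ) * demand q S lev i w ∧
    ∑ i ∈ range n, ∑ w ∈ words (lev i), (f w : ℝ) * demand q S lev i w + lev n ≤
      ((∑ i ∈ range n, f (W i) : ℕ) : ℝ) + slack (lev n) := by
  have hX : ∑ i ∈ range n, ∑ w ∈ words (lev i), (f w : ℝ) * demand q S lev i w =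
      ∑ w ∈ words (lev n), (f w : ℝ) * ∑ i ∈ range n, demand q S lev i w := by
    simp only [Finset.mul_sum]
    rw [Finset.sum_comm]
    refine Finset.sum_congr rfl fun i hi => ?_
    refine Finset.sum_subset (words_mono (h.mono (Finset.mem_range.1 hi).le)) fun w _ hw => ?_
    rw [demand, if_neg hw, mul_zero]
  have hF : ((∑ i ∈ range n, f (W i) : ℕ) : ℝ) =
      ∑ w ∈ words (lev n), (f w : ℝ) * ((∑ i ∈ range n, if W i = w then 1 else 0 : ℕ) : ℝ) := by
    push_cast
    simp only [Finset.mul_sum]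
    rw [Finset.sum_comm]
    refine Finset.sum_congr rfl fun i hi => ?_
    simp only [mul_ite, mul_one, mul_zero, Finset.sum_ite_eq]
    split_ifs with hw
    · rfl
    · rcases h.mem_words i with h0 | h0
      · exact_mod_cast Nat.eq_zero_of_le_zero ((hf (W i)).trans h0.le)
      · exact absurd (words_mono (h.mono (Finset.mem_range.1 hi).le) h0) hw
  have hD : ∀ w ∈ words (lev n), (0 : ℝ) ≤ ∑ i ∈ range n, demand q S lev i w -
      ((∑ i ∈ range n, if W i = w then 1 else 0 : ℕ) : ℝ) := fun w hw =>
    sub_nonneg.2 (h.count_le n w (by have := (_root_.mem_words.1 hw).1.1; omega))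
  rw [hX, hF]
  constructor
  · refine Finset.sum_le_sum fun w hw => ?_
    have := hD w hw
    gcongr
    linarith
  · have hdiff : ∑ w ∈ words (lev n), (f w : ℝ) * (∑ i ∈ range n, demand q S lev i w -
        ((∑ i ∈ range n, if W i = w then 1 else 0 : ℕ) : ℝ)) ≤
        lev n * ((words (lev n)).card + lev n + 1) := by
      refine le_trans (Finset.sum_le_sum fun w hw => ?_)
        ((Finset.mul_sum _ _ _).symm.le.trans
          (mul_le_mul_of_nonneg_left (h.deficit_le n) (Nat.cast_nonneg _)))
      refine mul_le_mul_of_nonneg_right ?_ (hD w hw)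
      exact_mod_cast (hf w).trans (_root_.mem_words.1 hw).1.2
    simp only [mul_sub, Finset.sum_sub_distrib] at hdiff
    unfold slack
    push_cast at hdiff ⊢
    linarith

end IsBalanced

/-! ### Asymptotics of block counts -/

lemma exists_sum_le_of_eventually {a b : ℕ → ℝ} (h : ∀ᶠ i in atTop, a i ≤ b i) :
    ∃ C, ∀ n, ∑ i ∈ range n, a i ≤ ∑ i ∈ range n, b i + C := by
  obtain ⟨X, hX⟩ := eventually_atTop.1 h
  refine ⟨∑ i ∈ range X, |a i - b i|, fun n => ?_⟩
  have h1 : ∑ i ∈ range n, (a i - b i) ≤ ∑ i ∈ range n, if i < X then |a i - b i| else 0 := by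
    refine Finset.sum_le_sum fun i _ => ?_
    split_ifs with hi
    · exact le_abs_self _
    · exact sub_nonpos.2 (hX i (not_lt.1 hi))
  have h2 : ∑ i ∈ range n, (if i < X then |a i - b i| else 0) ≤ ∑ i ∈ range X, |a i - b i| := by
    rw [← Finset.sum_filter]
    refine Finset.sum_le_sum_of_subset_of_nonneg (fun i hi => ?_) fun _ _ _ => abs_nonneg _
    exact Finset.mem_range.2 (Finset.mem_filter.1 hi).2
  rw [Finset.sum_sub_distrib] at h1
  linarith

lemma tendsto_div_of_tendsto_div {a b U : ℕ → ℝ} {c : ℝ}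
    (hab : Tendsto (fun n => a n / b n) atTop (𝓝 1))
    (haU : Tendsto (fun n => a n / U n) atTop (𝓝 c)) :
    Tendsto (fun n => b n / U n) atTop (𝓝 c) := by
  have h := haU.div hab one_ne_zero
  rw [div_one] at h
  refine h.congr' ?_
  filter_upwards [hab.eventually_ne one_ne_zero] with n hn
  have ha : a n ≠ 0 := fun h0 => hn (by rw [h0, zero_div])
  simp only [Pi.div_apply]
  rw [div_div_div_eq, mul_comm (a n) (b n), mul_div_mul_right _ _ ha]

lemma not_tendsto_div_zero {f U : ℕ → ℝ} (hU : Tendsto U atTop atTop) {C m : ℝ}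
    (h : ∀ n, U n ≤ C + m * f n) : ¬ Tendsto (fun n => f n / U n) atTop (𝓝 0) := by
  intro hf
  have h1 : Tendsto (fun n => C / U n + m * (f n / U n)) atTop (𝓝 (0 + m * 0)) :=
    (hU.const_div_atTop C).add (hf.const_mul m)
  rw [mul_zero, add_zero] at h1
  have h2 : (1 : ℝ) ≤ 0 := by
    refine ge_of_tendsto h1 ?_
    filter_upwards [hU.eventually_gt_atTop 0] with n hn
    rw [← mul_div_assoc, ← add_div, le_div_iff₀ hn, one_mul]
    exact h n
  exact absurd h2 (by norm_num)

lemma sum_range_mul (g : ℕ → ℝ) (m J : ℕ) :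
    ∑ i ∈ range (m * J), g i = ∑ j ∈ range J, ∑ i ∈ range m, g (m * j + i) := by
  induction J with
  | zero => simp
  | succ J ih => rw [Nat.mul_succ, Finset.sum_range_add, ih, Finset.sum_range_succ]

lemma sum_range_le_of_antitone {g : ℕ → ℝ} (hg : Antitone g) (h0 : ∀ n, 0 ≤ g n) {m r n J : ℕ}
    (hn : n ≤ r + m * J) :
    ∑ i ∈ range n, g i ≤ ∑ i ∈ range r, g i + m * ∑ j ∈ range J, g (m * j + r) := by
  calc ∑ i ∈ range n, g i ≤ ∑ i ∈ range (r + m * J), g i :=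
        Finset.sum_le_sum_of_subset_of_nonneg (Finset.range_mono hn) fun _ _ _ => h0 _
    _ = ∑ i ∈ range r, g i + ∑ j ∈ range J, ∑ i ∈ range m, g (r + (m * j + i)) := by
        rw [Finset.sum_range_add, sum_range_mul fun i => g (r + i)]
    _ ≤ ∑ i ∈ range r, g i + ∑ j ∈ range J, ∑ i ∈ range m, g (m * j + r) := by
        gcongr with j _ i _
        exact hg (by omega)
    _ = _ := by simp [Finset.mul_sum]

lemma mul_sum_le_of_antitone {g : ℕ → ℝ} (hg : Antitone g) (h0 : ∀ n, 0 ≤ g n) (m n : ℕ) :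
    m * ∑ j ∈ range (n / m + 1), g (m * j) ≤ m * g 0 + ∑ i ∈ range n, g i := by
  rw [Finset.sum_range_succ', mul_add, add_comm, mul_zero, Finset.mul_sum]
  gcongr
  calc ∑ j ∈ range (n / m), (m : ℝ) * g (m * (j + 1))
      ≤ ∑ j ∈ range (n / m), ∑ i ∈ range m, g (m * j + i) := by
        refine Finset.sum_le_sum fun j _ => ?_
        refine le_trans (le_of_eq (by simp)) (Finset.sum_le_sum (f := fun _ => g (m * (j + 1)))
          fun i hi => hg ?_)
        rw [Nat.mul_succ]
        exact Nat.add_le_add_left (Finset.mem_range.1 hi).le _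
    _ = ∑ i ∈ range (m * (n / m)), g i := (sum_range_mul _ _ _).symm
    _ ≤ ∑ i ∈ range n, g i :=
        Finset.sum_le_sum_of_subset_of_nonneg (Finset.range_mono (Nat.mul_div_le _ _))
          fun _ _ _ => h0 _

/-- The expected contribution of position `n` to the sum of `f` over all words. -/
noncomputable def expected (q : ℕ → ℕ) (S : Set ℕ) (lev : ℕ → ℕ) (f : Word → ℕ) (n : ℕ) : ℝ :=
  ∑ w ∈ words (lev n), (f w : ℝ) * demand q S lev n w

lemma expected_mono {q : ℕ → ℕ} (hq : IsBasic q) (S : Set ℕ) (lev : ℕ → ℕ) {f g : Word → ℕ}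
    (hfg : ∀ w, f w ≤ g w) (n : ℕ) : expected q S lev f n ≤ expected q S lev g n :=
  Finset.sum_le_sum fun w _ =>
    mul_le_mul_of_nonneg_right (by exact_mod_cast hfg w) (demand_nonneg hq S lev n w)

lemma expected_add (q : ℕ → ℕ) (S : Set ℕ) (lev : ℕ → ℕ) (f g : Word → ℕ) (n : ℕ) :
    expected q S lev (fun w => f w + g w) n = expected q S lev f n + expected q S lev g n := by
  simp [expected, add_mul, Finset.sum_add_distrib]

lemma expected_single (q : ℕ → ℕ) (S : Set ℕ) {lev : ℕ → ℕ} {n : ℕ} {w₀ : Word}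
    (hw : w₀ ∈ words (lev n)) :
    expected q S lev (fun w => if w = w₀ then 1 else 0) n = excess S w₀.1 * wt q w₀.1 n := by
  simp [expected, hw, demand]

namespace IsBalanced

variable {q : ℕ → ℕ} {S : Set ℕ} {lev : ℕ → ℕ} {W : ℕ → Word}

lemma eventually_mem_words (h : IsBalanced q S lev W) {w : Word} (hw : 1 ≤ w.1) :
    ∀ᶠ n in atTop, w ∈ words (lev n) := by
  filter_upwards [h.tendsto.eventually_ge_atTop w.1,
    h.tendsto.eventually_gt_atTop (Finset.univ.sup w.2)] with n h1 h2
  exact _root_.mem_words.2 ⟨⟨hw, h1⟩, fun p => (Finset.le_sup (Finset.mem_univ p)).trans_lt h2⟩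

lemma isLittleO_slack (h : IsBalanced q S lev W) {k : ℕ} (hk : 1 ≤ k) :
    (fun n => (slack (lev n) : ℝ)) =o[atTop] Qsum q k := by
  refine Asymptotics.isLittleO_iff.2 fun c hc => ?_
  filter_upwards [h.tendsto.eventually_ge_atTop k,
    (tendsto_natCast_atTop_atTop.comp h.tendsto).eventually_ge_atTop c⁻¹] with n h1 h2
  have h3 := h.slack_le n k hk h1
  simp only [Function.comp_apply] at h2
  have h4 : 1 ≤ c * (lev n : ℝ) := by
    rw [inv_le_iff_one_le_mul₀ hc] at h2
    linarith
  have h5 : (0 : ℝ) ≤ slack (lev n) := Nat.cast_nonneg _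
  rw [Real.norm_of_nonneg h5]
  calc (slack (lev n) : ℝ) ≤ c * lev n * slack (lev n) := le_mul_of_one_le_left h5 h4
    _ = c * (lev n * slack (lev n)) := by ring
    _ ≤ c * ‖Qsum q k n‖ := by
        gcongr
        exact h3.trans (le_abs_self _)

lemma isLittleO_digitCount_sub (h : IsBalanced q S lev W) (hinf : InfiniteInLimit q)
    (hdiv : FullyDivergent q) (d : ℕ) {m : ℕ} (hm : 0 < m) (r : ℕ) {k : ℕ} (hk : 0 < k)
    (B : Fin k → ℕ) {k' : ℕ} (hk' : 1 ≤ k') :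
    (fun n => (digitCount (layoutDigit q W) d m r B n : ℝ) -
      ∑ i ∈ range n, expected q S lev (patCount d m r B) i) =o[atTop] Qsum q k' := by
  obtain ⟨C₁, hC₁⟩ := h.exists_digitCount_le hinf d hm r hk B
  obtain ⟨C₂, hC₂⟩ := h.exists_le_digitCount q d hm r B
  have hconst : (fun _ : ℕ => ((C₁ + C₂ : ℕ) : ℝ)) =o[atTop] Qsum q k' :=
    Asymptotics.isLittleO_const_left.2
      (Or.inr (tendsto_norm_atTop_atTop.comp (hdiv k' hk')))
  refine (Asymptotics.IsBigO.of_bound 1 (Eventually.of_forall fun n => ?_)).trans_isLittleO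
    (hconst.add (h.isLittleO_slack hk'))
  have h1 : (digitCount (layoutDigit q W) d m r B n : ℝ) ≤
      ((∑ i ∈ range n, patCount d m r B (W i) : ℕ) : ℝ) + C₁ := by exact_mod_cast hC₁ n
  have h2 : ((∑ i ∈ range n, patCount d m r B (W i) : ℕ) : ℝ) ≤
      digitCount (layoutDigit q W) d m r B n + C₂ + lev n := by exact_mod_cast hC₂ n
  obtain ⟨h3, h4⟩ := h.sum_le_expected (patCount_le d m r B) n
  have h5 : (0 : ℝ) ≤ slack (lev n) := Nat.cast_nonneg _
  have h6 : (0 : ℝ) ≤ C₁ := Nat.cast_nonneg _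
  have h7 : (0 : ℝ) ≤ C₂ := Nat.cast_nonneg _
  rw [one_mul, Real.norm_of_nonneg (r := ((C₁ + C₂ : ℕ) : ℝ) + slack (lev n)) (by positivity),
    Real.norm_eq_abs, abs_le]
  unfold expected
  push_cast at h3 h4 h1 h2 ⊢
  constructor <;> linarith

lemma expected_patCount_eq (h : IsBalanced q S lev W) {d : ℕ} (hd : 0 < d) (m r : ℕ) {k : ℕ}
    (B₁ B₂ : Fin k → ℕ) : ∀ᶠ n in atTop,
    expected q S lev (patCount d m r B₁) n = expected q S lev (patCount d m r B₂) n := by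
  filter_upwards [h.tendsto.eventually_gt_atTop (Finset.univ.sup B₁),
    h.tendsto.eventually_gt_atTop (Finset.univ.sup B₂)] with n h1 h2
  rw [expected, expected, sum_demand, sum_demand]
  refine Finset.sum_congr rfl fun ℓ _ => ?_
  rw [sum_patCount hd fun j => (Finset.le_sup (Finset.mem_univ j)).trans_lt h1,
    sum_patCount hd fun j => (Finset.le_sup (Finset.mem_univ j)).trans_lt h2]

lemma wt_le_expected (h : IsBalanced q S lev W) (hq : IsBasic q) {d m r k : ℕ} (hd : 0 < d)
    (hr : r < m) (hk : 0 < k) (B : Fin k → ℕ) : ∀ᶠ n in atTop,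
    wt q (r + d * (k - 1) + 1) n ≤ expected q S lev (patCount d m r B) n := by
  obtain ⟨w, hw, hpos⟩ := exists_patCount_pos d m hr hd hk B
  filter_upwards [h.eventually_mem_words (w := w) (by omega)] with n hn
  have h1 := expected_mono hq S lev (f := fun v => if v = w then 1 else 0)
    (g := patCount d m r B) (fun v => by split_ifs with hv <;> simp_all) n
  rw [expected_single q S hn, hw] at h1
  exact (le_mul_of_one_le_left (wt_pos hq _ _).le (one_le_excess _ _)).trans h1

lemma expected_le (h : IsBalanced q S lev W) (hq : IsBasic q) (hmono : Monotone q) {k : ℕ}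
    (hk : 0 < k) (B : Fin k → ℕ) : ∀ᶠ n in atTop,
    expected q S lev (patCount 1 1 0 B) n ≤ excess S k * wt q k n + 2 / lev n * wt q k n := by
  filter_upwards [h.tendsto.eventually_gt_atTop (Finset.univ.sup B),
    h.tendsto.eventually_ge_atTop k] with n h1 h2
  rw [expected, sum_demand]
  have hg := h.growth_le n
  set N := lev n
  have hN : (0 : ℝ) < N := by exact_mod_cast hk.trans_le h2
  have hqpos : (0 : ℝ) < q n := by have := hq n; positivity
  have hNq : (N : ℝ) ^ 4 ≤ q n := by
    have : N ^ 4 ≤ q n := le_trans (by unfold growth; omega) hg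
    exact_mod_cast this
  have hN4 : (N : ℝ) ≤ (N : ℝ) ^ 4 := by exact_mod_cast Nat.le_self_pow (by norm_num) N
  have hNq1 : (N : ℝ) * (q n : ℝ)⁻¹ ≤ 1 := by
    rw [← div_eq_mul_inv, div_le_one hqpos]; linarith
  have hwt := (wt_pos hq k n).le
  have hterm : ∀ ℓ ∈ Finset.Icc 1 N, excess S ℓ * wt q ℓ n *
      ((∑ v ∈ Fintype.piFinset fun _ : Fin ℓ => Finset.range N,
        patCount 1 1 0 B ⟨ℓ, v⟩ : ℕ) : ℝ) ≤
      (if ℓ = k then excess S k * wt q k n else 0) +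
        2 * N * (N * (q n : ℝ)⁻¹) * wt q k n := by
    intro ℓ hℓ
    have hex : 0 ≤ excess S ℓ * wt q ℓ n :=
      mul_nonneg (zero_le_one.trans (one_le_excess _ _)) (wt_pos hq _ _).le
    have hcount := sum_patCount_le (N := N) (ℓ := ℓ) hk
      fun j => (Finset.le_sup (Finset.mem_univ j)).trans_lt h1
    have herr : 0 ≤ 2 * N * (N * (q n : ℝ)⁻¹) * wt q k n := mul_nonneg (by positivity) hwt
    refine (mul_le_mul_of_nonneg_left (Nat.cast_le.2 hcount) hex).trans ?_
    rcases lt_trichotomy ℓ k with hlt | heq | hgt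
    · simpa [hlt, hlt.ne] using herr
    · subst heq
      simpa using herr
    · rw [if_neg (by omega), if_neg (by omega), if_neg (by omega), zero_add]
      obtain ⟨p, rfl⟩ := Nat.exists_eq_add_of_lt hgt
      rw [add_assoc, Nat.add_sub_cancel_left]
      have hℓN : ((k + (p + 1) : ℕ) : ℝ) ≤ N := by
        exact_mod_cast (Finset.mem_Icc.1 hℓ).2
      calc excess S (k + (p + 1)) * wt q (k + (p + 1)) n * (((k + (p + 1)) * N ^ (p + 1) : ℕ) : ℝ)
          ≤ 2 * (wt q k n * ((q n : ℝ)⁻¹) ^ (p + 1)) * (N * N ^ (p + 1)) := by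
            rw [Nat.cast_mul, Nat.cast_pow]
            gcongr
            · exact (wt_pos hq _ _).le
            · exact excess_le_two _ _
            · exact wt_add_le hq hmono _ _ _
        _ = 2 * N * (N * (q n : ℝ)⁻¹) ^ (p + 1) * wt q k n := by rw [mul_pow]; ring
        _ ≤ _ := by
            gcongr
            exact pow_le_of_le_one (by positivity) hNq1 (by omega)
  refine (Finset.sum_le_sum hterm).trans ?_
  rw [Finset.sum_add_distrib, Finset.sum_ite_eq', if_pos (Finset.mem_Icc.2 ⟨hk, h2⟩),
    Finset.sum_const, Nat.card_Icc, Nat.add_sub_cancel, nsmul_eq_mul, ← mul_assoc]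
  gcongr
  rw [le_div_iff₀ hN]
  calc (N : ℝ) * (2 * N * (N * (q n : ℝ)⁻¹)) * N = 2 * ((N : ℝ) ^ 4 / q n) := by
        rw [div_eq_mul_inv]; ring
    _ ≤ 2 * 1 := by gcongr; exact (div_le_one hqpos).2 hNq
    _ = 2 := mul_one _

/-- Occurrences of `B` start only at positions divisible by `m`, up to a negligible proportion. -/
lemma isLittleO_expected_sub (h : IsBalanced q S lev W) (hq : IsBasic q) (hmono : Monotone q)
    (m r : ℕ) {k : ℕ} (hk : 0 < k) (B : Fin k → ℕ) :
    (fun n => expected q S lev (patCount 1 m r B) n -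
      (if r = 0 then excess S k else 0) * wt q k n) =o[atTop] wt q k := by
  have hlim : Tendsto (fun n => 2 / (lev n : ℝ)) atTop (𝓝 0) :=
    (tendsto_natCast_atTop_atTop.comp h.tendsto).const_div_atTop 2
  have herr : (fun n => 2 / (lev n : ℝ) * wt q k n) =o[atTop] wt q k := by
    simpa using ((Asymptotics.isLittleO_one_iff ℝ).2 hlim).mul_isBigO
      (Asymptotics.isBigO_refl (wt q k) atTop)
  refine (Asymptotics.IsBigO.of_bound 1 ?_).trans_isLittleO herr
  filter_upwards [h.expected_le hq hmono hk B,
    h.eventually_mem_words (w := ⟨k, B⟩) hk] with n h1 h2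
  have hwt := (wt_pos hq k n).le
  have hsingle := expected_single q S h2
  rw [one_mul, Real.norm_of_nonneg (mul_nonneg (by positivity) hwt), Real.norm_eq_abs, abs_le]
  split_ifs with hr
  · subst hr
    have h3 := expected_mono hq S lev (f := patCount 1 m 0 B) (g := patCount 1 1 0 B)
      (fun w => Finset.card_le_card fun o ho => by
        rw [Finset.mem_filter] at ho ⊢
        exact ⟨ho.1, Nat.mod_one _, ho.2.2⟩) n
    have h4 := expected_mono hq S lev (f := fun w => if w = ⟨k, B⟩ then 1 else 0)
      (g := patCount 1 m 0 B) (fun w => by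
        split_ifs with hw
        · subst hw; exact patCount_self hk B
        · exact Nat.zero_le _) n
    have h5 : 0 ≤ 2 / (lev n : ℝ) * wt q k n := mul_nonneg (by positivity) hwt
    constructor <;> linarith
  · have h3 := expected_mono hq S lev
      (patCount_add_self_le (m := m) (Nat.pos_of_ne_zero hr) hk B) n
    rw [expected_add, hsingle] at h3
    have h4 : 0 ≤ expected q S lev (patCount 1 m r B) n :=
      Finset.sum_nonneg fun w _ => mul_nonneg (Nat.cast_nonneg _) (demand_nonneg hq S lev n w)
    have h5 : 0 ≤ 2 / (lev n : ℝ) * wt q k n := mul_nonneg (by positivity) hwt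
    constructor <;> linarith

theorem tendsto_digitCount_div (h : IsBalanced q S lev W) (hq : IsBasic q)
    (hdiv : FullyDivergent q) (hmono : Monotone q) (hinf : InfiniteInLimit q)
    {m : ℕ} (hm : 0 < m) (r : ℕ) {k : ℕ} (hk : 0 < k) (B : Fin k → ℕ) :
    Tendsto (fun n => (digitCount (layoutDigit q W) 1 m r B n : ℝ) / Qsum q k n) atTop
      (𝓝 (if r = 0 then excess S k else 0)) := by
  set c : ℝ := if r = 0 then excess S k else 0
  have h1 := (h.isLittleO_expected_sub hq hmono m r hk B).sum_range
    (fun n => (wt_pos hq k n).le) (hdiv k hk)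
  have h2 : (fun n => (digitCount (layoutDigit q W) 1 m r B n : ℝ) - c * Qsum q k n)
      =o[atTop] Qsum q k := by
    refine ((h.isLittleO_digitCount_sub hinf hdiv 1 hm r hk B hk).add h1).congr_left fun n => ?_
    simp only [Finset.sum_sub_distrib, ← Finset.mul_sum]
    rw [sub_add_sub_cancel]
    rfl
  have h3 := h2.tendsto_div_nhds_zero.add_const c
  rw [zero_add] at h3
  refine h3.congr' ?_
  filter_upwards [(hdiv k hk).eventually_gt_atTop 0] with n hn
  field_simp
  ring

theorem tendsto_digitCount_div_digitCount (h : IsBalanced q S lev W) (hq : IsBasic q)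
    (hdiv : FullyDivergent q) (hinf : InfiniteInLimit q) {d : ℕ} (hd : 0 < d)
    {m r : ℕ} (hr : r < m) {k : ℕ} (hk : 0 < k) (B₁ B₂ : Fin k → ℕ) :
    Tendsto (fun n => (digitCount (layoutDigit q W) d m r B₁ n : ℝ) /
      (digitCount (layoutDigit q W) d m r B₂ n : ℝ)) atTop (𝓝 1) := by
  have hm : 0 < m := by omega
  set k' := r + d * (k - 1) + 1
  have hk' : 1 ≤ k' := Nat.le_add_left _ _
  have hU := hdiv k' hk'
  have ho : ∀ C : ℝ, (fun _ : ℕ => C) =o[atTop] Qsum q k' := fun C =>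
    Asymptotics.isLittleO_const_left.2 (Or.inr (tendsto_norm_atTop_atTop.comp hU))
  have hD := fun B : Fin k → ℕ => h.isLittleO_digitCount_sub hinf hdiv d hm r hk B hk'
  have hX : (fun n => ∑ i ∈ range n, expected q S lev (patCount d m r B₁) i -
      ∑ i ∈ range n, expected q S lev (patCount d m r B₂) i) =o[atTop] Qsum q k' := by
    have heq := h.expected_patCount_eq hd m r B₁ B₂
    obtain ⟨C, hC⟩ := exists_sum_le_of_eventually (heq.mono fun _ => le_of_eq)
    obtain ⟨C', hC'⟩ := exists_sum_le_of_eventually (heq.mono fun _ => ge_of_eq)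
    refine (Asymptotics.IsBigO.of_bound 1 (Eventually.of_forall fun n => ?_)).trans_isLittleO
      (ho (|C| + |C'|))
    have h1 := hC n
    have h2 := hC' n
    have h3 := le_abs_self C
    have h4 := le_abs_self C'
    rw [one_mul, Real.norm_of_nonneg (r := |C| + |C'|) (by positivity), Real.norm_eq_abs, abs_le]
    constructor <;> linarith [abs_nonneg C, abs_nonneg C']
  have hsub : (fun n => (digitCount (layoutDigit q W) d m r B₁ n : ℝ) -
      digitCount (layoutDigit q W) d m r B₂ n) =o[atTop] Qsum q k' :=
    (((hD B₁).sub (hD B₂)).add hX).congr_left fun n => by ring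
  have hbig : ∀ᶠ n in atTop, Qsum q k' n ≤ 2 * digitCount (layoutDigit q W) d m r B₂ n := by
    obtain ⟨C, hC⟩ := exists_sum_le_of_eventually (h.wt_le_expected hq hd hr hk B₂)
    filter_upwards [((hD B₂).add (ho (-C))).bound (c := 1 / 2) (by norm_num),
      hU.eventually_gt_atTop 0] with n h1 h2
    rw [Real.norm_of_nonneg h2.le, Real.norm_eq_abs, abs_le] at h1
    have h3 : Qsum q k' n ≤ _ := hC n
    linarith [h1.1]
  have hO : Qsum q k' =O[atTop] fun n => (digitCount (layoutDigit q W) d m r B₂ n : ℝ) := by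
    refine Asymptotics.IsBigO.of_bound 2 ?_
    filter_upwards [hbig, hU.eventually_gt_atTop 0] with n h1 h2
    rwa [Real.norm_of_nonneg h2.le, Real.norm_of_nonneg (Nat.cast_nonneg _)]
  refine (Asymptotics.isEquivalent_iff_tendsto_one ?_).1 (hsub.trans_isBigO hO)
  filter_upwards [hbig, hU.eventually_gt_atTop 0] with n h1 h2
  intro h0
  rw [h0] at h1
  linarith

end IsBalanced

/-! ### Block counts of the constructed number -/

lemma blockCount_cantorSum {q E : ℕ → ℕ} (hq : IsBasic q) (hE : ∀ n, E n ≤ q n - 2)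
    {k : ℕ} (B : Fin k → ℕ) (n : ℕ) :
    blockCount q (cantorSum q E) B n = digitCount E 1 1 0 B n := by
  simp [blockCount, digitCount, qdigit_cantorSum hq hE, Nat.mod_one]

lemma apCount_cantorSum {q E : ℕ → ℕ} (hq : IsBasic q) (hE : ∀ n, E n ≤ q n - 2)
    (m r : ℕ) (B : Fin m → ℕ) (n : ℕ) :
    apCount q (cantorSum q E) m r B n = digitCount E 1 m r B n := by
  simp [apCount, digitCount, qdigit_cantorSum hq hE]

lemma blockCount_Ups_cantorSum {q E : ℕ → ℕ} (hq : IsBasic q) (hE : ∀ n, E n ≤ q n - 2)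
    {m r : ℕ} (hr : r < m) {k : ℕ} (B : Fin k → ℕ) (n : ℕ) :
    blockCount (lamQ q m r) (Ups q m r (cantorSum q E)) B n = digitCount E m m r B (m * n) := by
  have hU : Ups q m r (cantorSum q E) = cantorSum (lamQ q m r) fun t => E (m * t + r) := by
    simp only [Ups, qdigit_cantorSum hq hE]
    rfl
  have hm : 0 < m := by omega
  rw [hU, blockCount, digitCount]
  simp only [qdigit_cantorSum (q := lamQ q m r) (fun t => hq _) (fun t => hE _)]
  refine Finset.card_bij (fun t _ => m * t + r) (fun t ht => ?_) (fun s _ t _ hst => ?_)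
    fun p hp => ?_
  · rw [Finset.mem_filter, Finset.mem_range] at ht ⊢
    refine ⟨?_, ?_, fun j => ?_⟩
    · calc m * t + r < m * (t + 1) := by rw [Nat.mul_succ]; omega
        _ ≤ m * n := Nat.mul_le_mul_left _ ht.1
    · rw [Nat.mul_add_mod, Nat.mod_eq_of_lt hr]
    · rw [← ht.2 j]
      ring_nf
  · exact Nat.eq_of_mul_eq_mul_left hm (Nat.add_right_cancel hst)
  · rw [Finset.mem_filter, Finset.mem_range] at hp
    have hdm := Nat.div_add_mod p m
    rw [hp.2.1] at hdm
    refine ⟨p / m, Finset.mem_filter.2 ⟨Finset.mem_range.2 (Nat.div_lt_of_lt_mul hp.1),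
      fun j => ?_⟩, hdm⟩
    rw [← hp.2.2 j, Nat.mul_add, ← hdm]
    congr 1
    rw [hdm]
    omega

/-- If `Q` is a basic sequence which is fully divergent, non-decreasing, and infinite in
limit, and `S` is almost closed under addition, then
`RN^{I}(Q) ∩ RN^{II}(Q) ∩ N^{I}_{Ab}(Q) ∩ ⋂_{k∈S} N_k(Q) \ (N^{II}(Q) ∪ ⋃_{k∉S} N_k(Q))`
is non-empty. -/
theorem stmt4 (Q : ℕ → ℕ) (hQ : IsBasic Q) (hdiv : FullyDivergent Q)
    (hmono : Monotone Q) (hinf : InfiniteInLimit Q)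
    (S : Set ℕ) (hSpos : 0 ∉ S) (hS : AlmostClosed S) :
    (({x : ℝ | MemRNI Q x} ∩ {x : ℝ | MemRNII Q x} ∩ {x : ℝ | APAbnormalI Q x} ∩
      (⋂ k ∈ S, {x : ℝ | QNormalOfOrder Q k x})) \
      ({x : ℝ | APNormalII Q x} ∪
        ⋃ k ∈ {k : ℕ | 1 ≤ k ∧ k ∉ S}, {x : ℝ | QNormalOfOrder Q k x})).Nonempty := by
  obtain ⟨lev, W, h⟩ := exists_isBalanced hQ hdiv hmono hinf S
  have hE := h.layoutDigit_le_sub_two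
  have hcount := fun {k : ℕ} (hk : 0 < k) {m : ℕ} (hm : 0 < m) (r : ℕ) =>
    h.tendsto_digitCount_div hQ hdiv hmono hinf hm r hk
  refine ⟨cantorSum Q (layoutDigit Q W), ⟨⟨⟨?_, ?_⟩, ?_⟩, ?_⟩, ?_⟩
  · intro m hm r hr B₁ B₂
    simp only [apCount_cantorSum hQ hE]
    exact h.tendsto_digitCount_div_digitCount hQ hdiv hinf one_pos hr hm B₁ B₂
  · intro k hk m hm r hr B₁ B₂
    simp only [blockCount_Ups_cantorSum hQ hE hr]
    exact (h.tendsto_digitCount_div_digitCount hQ hdiv hinf hm hr hk B₁ B₂).comp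
      (tendsto_id.const_mul_atTop' hm)
  · intro m hm r hr hx
    have hm0 : 0 < m := by omega
    have h1 := hx fun _ => 0
    simp only [apCount_cantorSum hQ hE] at h1
    have h2 := tendsto_div_of_tendsto_div h1 (hcount hm0 hm0 r fun _ => 0)
    split_ifs at h2 with hr0
    · subst hr0
      have h3 : Tendsto (fun n => wt Q m 0 / Qsum Q m n + 1 / m) atTop (𝓝 (0 + 1 / m)) :=
        ((hdiv m hm0).const_div_atTop _).add_const _
      have h4 : excess S m ≤ 0 + 1 / (m : ℝ) := by
        refine le_of_tendsto_of_tendsto h2 h3 ?_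
        filter_upwards [(hdiv m hm0).eventually_gt_atTop 0] with n hn
        have h5 := mul_sum_le_of_antitone (wt_antitone hQ hmono m) (fun i => (wt_pos hQ m i).le) m n
        have hm' : (0 : ℝ) < m := by exact_mod_cast hm0
        have h6 : (m : ℝ) * apQsum Q m 0 n ≤ m * wt Q m 0 + Qsum Q m n := h5
        rw [div_le_iff₀ hn, add_mul, div_mul_cancel₀ _ hn.ne', ← sub_nonneg]
        have h7 : wt Q m 0 + 1 / m * Qsum Q m n - apQsum Q m 0 n =
            (m * wt Q m 0 + Qsum Q m n - m * apQsum Q m 0 n) / m := by field_simp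
        rw [h7]
        exact div_nonneg (sub_nonneg.2 h6) hm'.le
      have h5 := one_le_excess S m
      have h6 : 1 / (m : ℝ) ≤ 1 / 2 := by gcongr; exact_mod_cast hm
      linarith
    · refine not_tendsto_div_zero (hdiv m hm0) (C := ∑ i ∈ range r, wt Q m i) (m := m)
        (fun n => ?_) h2
      refine sum_range_le_of_antitone (wt_antitone hQ hmono m) (fun i => (wt_pos hQ m i).le) ?_
      have h3 := Nat.div_add_mod (n - r) m
      have h4 := Nat.mod_lt (n - r) hm0
      rw [Nat.mul_succ]
      omega
  · simp only [Set.mem_iInter]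
    intro k hk B
    have hk0 : 0 < k := Nat.pos_of_ne_zero fun h0 => hSpos (h0 ▸ hk)
    simp only [blockCount_cantorSum hQ hE]
    simpa [excess, hk] using hcount hk0 one_pos 0 B
  · rintro (hx | hx)
    · have h1 := hx 1 le_rfl 2 (by norm_num) 1 (by norm_num) fun _ => 0
      simp only [blockCount_Ups_cantorSum hQ hE one_lt_two] at h1
      have h2 := (hcount one_pos two_pos 1 fun _ => 0).comp
        (tendsto_id.const_mul_atTop' (two_pos (α := ℕ)))
      rw [if_neg one_ne_zero] at h2
      have h3 := tendsto_div_of_tendsto_div (U := fun n => Qsum Q 1 (2 * n)) h1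
        (h2.congr fun n => by simp [digitCount])
      refine not_tendsto_div_zero
        ((hdiv 1 le_rfl).comp (tendsto_id.const_mul_atTop' (two_pos (α := ℕ))))
        (C := ∑ i ∈ range 1, wt Q 1 i) (m := (2 : ℕ)) (fun n => ?_) h3
      have h4 := sum_range_le_of_antitone (wt_antitone hQ hmono 1) (fun i => (wt_pos hQ 1 i).le)
        (m := 2) (r := 1) (n := 2 * n) (J := n) (by omega)
      have h5 : Qsum (lamQ Q 2 1) 1 n = ∑ j ∈ range n, wt Q 1 (2 * j + 1) := by
        simp [Qsum, lamQ, wt]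
      rw [h5]
      exact h4
    · simp only [Set.mem_iUnion] at hx
      obtain ⟨k, ⟨hk, hkS⟩, hx⟩ := hx
      have h1 := hx fun _ => 0
      simp only [blockCount_cantorSum hQ hE] at h1
      have h2 := tendsto_nhds_unique h1 (hcount hk one_pos 0 fun _ => 0)
      norm_num [excess, hkS] at h2
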